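/- arXiv:2503.12859 — 4 statements merged into one kernel-verified Lean document; each statement's English description precedes it below -/
import Mathlib

section
/- Let G be an n×n real matrix with positive definite symmetric part, and suppose ℓ is a 1-permanental random vector with kernel G, i.e. a random vector with values in ℝ₊ⁿ such that E[exp(−⟨λ,ℓ⟩)] = det(I + diag(λ)·G)⁻¹ for all λ ∈ ℝ₊ⁿ. Then the law of ℓ is absolutely continuous with respect to Lebesgue measure on ℝ₊ⁿ, with density ρ(l) = (2π)⁻ⁿ det(G)⁻¹ ∫_{[0,2π)ⁿ} exp( Σ_{i,j} Q_{ij} √(l_i l_j) e^{𝕚(θ_i−θ_j)} ) dθ₁⋯dθₙ, where Q := −G⁻¹ and 𝕚 = √−1. -/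
open Matrix MeasureTheory

/-- The density formula for a 1-permanental vector with kernel `G`:
`ρ(l) = (2π)⁻ⁿ det(G)⁻¹ ∫_{[0,2π)ⁿ} exp( Σ_{i,j} Q_{ij} √(l_i l_j) e^{𝕚(θ_i−θ_j)} ) dθ`,
where `Q = −G⁻¹`. -/
noncomputable def permDensity {n : ℕ} (G : Matrix (Fin n) (Fin n) ℝ) (l : Fin n → ℝ) : ℂ :=
  (((2 * Real.pi)⁻¹ : ℝ) ^ n : ℝ) * ((G.det⁻¹ : ℝ) : ℂ) *
    ∫ θ : Fin n → ℝ in Set.univ.pi fun _ : Fin n => Set.Ico (0 : ℝ) (2 * Real.pi),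
      Complex.exp (∑ i, ∑ j, ((-(G⁻¹ i j) : ℝ) : ℂ) * ((Real.sqrt (l i * l j) : ℝ) : ℂ) *
        Complex.exp (Complex.I * (((θ i : ℝ) : ℂ) - ((θ j : ℝ) : ℂ))))

open Matrix MeasureTheory
open scoped ComplexConjugate

lemma gauss1_int {a : ℝ} (ha : 0 < a) (b c : ℂ) :
    ∫ z : ℂ, Complex.exp (-((a : ℂ) * (z * conj z) + z * c + conj z * b)) =
      (Real.pi / a : ℂ) * Complex.exp (b * c / a) := by
  have ha' : (a : ℂ) ≠ 0 := by exact_mod_cast ha.ne'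
  rw [← (Complex.volume_preserving_equiv_real_prod.symm).integral_comp
    Complex.measurableEquivRealProd.symm.measurableEmbedding]
  have h : ∀ p : ℝ × ℝ, Complex.exp (-((a : ℂ) * (Complex.measurableEquivRealProd.symm p *
      conj (Complex.measurableEquivRealProd.symm p)) + Complex.measurableEquivRealProd.symm p * c +
        conj (Complex.measurableEquivRealProd.symm p) * b)) =
      Complex.exp ((-a : ℂ) * (p.1 : ℂ) ^ 2 + (-(b + c)) * p.1 + 0) *
      Complex.exp ((-a : ℂ) * (p.2 : ℂ) ^ 2 + (Complex.I * (b - c)) * p.2 + 0) := by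
    intro p
    rw [← Complex.exp_add]
    congr 1
    have h1 : Complex.measurableEquivRealProd.symm p = (p.1 : ℂ) + p.2 * Complex.I := by
      rw [Complex.measurableEquivRealProd_symm_apply]
      apply Complex.ext <;> simp
    rw [h1]
    simp only [map_add, map_mul, Complex.conj_ofReal, Complex.conj_I]
    linear_combination (a : ℂ) * p.2 ^ 2 * Complex.I_sq
  simp_rw [h]
  have hre : (-a : ℂ).re < 0 := by simpa using ha
  rw [Measure.volume_eq_prod, integral_prod_mul (fun x : ℝ => Complex.exp ((-a : ℂ) * (x : ℂ) ^ 2 + (-(b + c)) * x + 0))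
    (fun x : ℝ => Complex.exp ((-a : ℂ) * (x : ℂ) ^ 2 + (Complex.I * (b - c)) * x + 0)),
    integral_cexp_quadratic hre, integral_cexp_quadratic hre]
  have h2 : (Real.pi / - -(a : ℂ)) ^ (1 / 2 : ℂ) * (Real.pi / - -(a : ℂ)) ^ (1 / 2 : ℂ) = Real.pi / a := by
    rw [← Complex.cpow_add]
    · norm_num
    · simp [ha', Real.pi_ne_zero]
  rw [mul_mul_mul_comm, h2, ← Complex.exp_add]
  congr 2
  field_simp
  ring_nf
  simp only [Complex.I_sq]
  ring

noncomputable def polarPhi (p : ℝ × ℝ) : ℂ := (Real.sqrt p.1 : ℂ) * Complex.exp (Complex.I * p.2)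

lemma polarPhi_meas : Measurable polarPhi := by
  unfold polarPhi
  fun_prop

noncomputable def nuL : Measure ℝ := volume.restrict (Set.Ioi 0)
noncomputable def nuT : Measure ℝ := volume.restrict (Set.Ioo (-Real.pi) Real.pi)
noncomputable def kap : Measure ℂ := (2 : NNReal) • volume

instance : SigmaFinite nuL := by unfold nuL; infer_instance
instance : IsFiniteMeasure nuT := by unfold nuT; infer_instance
instance : SigmaFinite kap := by unfold kap; infer_instance

lemma sq_change (g : ℝ → ENNReal) :
    ∫⁻ l in Set.Ioi (0 : ℝ), g l = ∫⁻ r in Set.Ioi (0 : ℝ), ENNReal.ofReal (2 * r) * g (r ^ 2) := by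
  have himg : (fun r : ℝ => r ^ 2) '' Set.Ioi 0 = Set.Ioi 0 := by
    ext x
    constructor
    · rintro ⟨y, hy, rfl⟩
      exact pow_pos (Set.mem_Ioi.1 hy) 2
    · intro hx
      exact ⟨Real.sqrt x, Real.sqrt_pos.2 hx, Real.sq_sqrt (le_of_lt hx)⟩
  conv_lhs => rw [← himg]
  rw [lintegral_image_eq_lintegral_abs_deriv_mul (f' := fun r => 2 * r) measurableSet_Ioi]
  · refine setLIntegral_congr_fun measurableSet_Ioi fun r hr => ?_
    have : (0:ℝ) < r := hr
    rw [abs_of_pos (by positivity)]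
  · intro x hx
    simpa using (hasDerivAt_pow 2 x).hasDerivWithinAt
  · intro x hx y hy hxy
    have hx' : (0:ℝ) < x := hx
    have hy' : (0:ℝ) < y := hy
    exact (pow_left_inj₀ hx'.le hy'.le two_ne_zero).1 hxy

lemma polar_map : Measure.map polarPhi (nuL.prod nuT) = kap := by
  refine Measure.ext_of_lintegral _ fun f hf => ?_
  rw [lintegral_map hf polarPhi_meas, lintegral_prod_symm (fun a => f (polarPhi a))
    (hf.comp polarPhi_meas).aemeasurable]
  have h1 : ∀ t : ℝ, ∫⁻ l, f (polarPhi (l, t)) ∂nuL =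
      2 * ∫⁻ r in Set.Ioi (0 : ℝ), ENNReal.ofReal r * f (Complex.polarCoord.symm (r, t)) := by
    intro t
    rw [nuL, sq_change, ← lintegral_const_mul']
    · refine setLIntegral_congr_fun measurableSet_Ioi fun r hr => ?_
      have hr' : (0:ℝ) < r := hr
      rw [ENNReal.ofReal_mul (by norm_num), mul_assoc]
      congr 3
      · simp
      · simp only [polarPhi, Complex.polarCoord_symm_apply]
        rw [Real.sqrt_sq hr'.le, mul_comm Complex.I, Complex.exp_mul_I]
        simp
    · simp
  simp_rw [h1]
  rw [lintegral_const_mul' _ _ (by simp)]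
  rw [kap, lintegral_smul_measure, ← Complex.lintegral_comp_polarCoord_symm]
  have : (volume : Measure (ℝ × ℝ)).restrict polarCoord.target = nuL.prod nuT := by
    rw [nuL, nuT, Measure.prod_restrict]; rfl
  rw [this, lintegral_prod_symm]
  · rfl
  · refine Measurable.aemeasurable ?_
    simp_rw [Complex.polarCoord_symm_apply]
    simp only [smul_eq_mul]
    fun_prop

def PD {n : ℕ} (A : Matrix (Fin n) (Fin n) ℝ) : Prop :=
  ∀ x : Fin n → ℝ, x ≠ 0 → 0 < x ⬝ᵥ A.mulVec x

lemma dot_mulVec_eq {n : ℕ} (A : Matrix (Fin n) (Fin n) ℝ) (x : Fin n → ℝ) :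
    x ⬝ᵥ A.mulVec x = ∑ i, ∑ j, A i j * (x i * x j) := by
  simp only [dotProduct, mulVec, Finset.mul_sum]
  refine Finset.sum_congr rfl fun i _ => Finset.sum_congr rfl fun j _ => by ring

/-- The sesquilinear form. -/
noncomputable def qf {n : ℕ} (A : Matrix (Fin n) (Fin n) ℝ) (z : Fin n → ℂ) : ℂ :=
  ∑ i, ∑ j, (A i j : ℂ) * (z i * conj (z j))

lemma qf_cont {n : ℕ} (A : Matrix (Fin n) (Fin n) ℝ) : Continuous (qf A) := by
  unfold qf
  have : Continuous (fun z : ℂ => conj z) := Complex.continuous_conj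
  fun_prop

lemma PD.lower {n : ℕ} {A : Matrix (Fin n) (Fin n) ℝ} (hA : PD A) :
    ∃ c : ℝ, 0 < c ∧ ∀ x : Fin n → ℝ, c * ∑ i, x i ^ 2 ≤ x ⬝ᵥ A.mulVec x := by
  rcases Nat.eq_zero_or_pos n with rfl | hn
  · exact ⟨1, one_pos, fun x => by simp⟩
  have : Nonempty (Fin n) := ⟨⟨0, hn⟩⟩
  have hcont : Continuous fun x : Fin n → ℝ => x ⬝ᵥ A.mulVec x := by
    simp_rw [dot_mulVec_eq]; fun_prop
  obtain ⟨x0, hx0, hmin⟩ := (isCompact_sphere (0 : Fin n → ℝ) 1).exists_isMinOn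
    (NormedSpace.sphere_nonempty.2 zero_le_one) hcont.continuousOn
  have hx0' : x0 ≠ 0 := by
    rintro rfl
    simp at hx0
  have hm := hA x0 hx0'
  set m := x0 ⬝ᵥ A.mulVec x0 with hmdef
  have hn' : (0:ℝ) < n := by exact_mod_cast hn
  refine ⟨m / n, by positivity, fun x => ?_⟩
  have h1 : ∑ i, x i ^ 2 ≤ n * ‖x‖ ^ 2 := by
    calc ∑ i, x i ^ 2 ≤ ∑ i : Fin n, ‖x‖ ^ 2 := by
          refine Finset.sum_le_sum fun i _ => ?_
          rw [← sq_abs]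
          have := norm_le_pi_norm x i
          rw [Real.norm_eq_abs] at this
          gcongr
      _ = _ := by simp
  have h2 : m * ‖x‖ ^ 2 ≤ x ⬝ᵥ A.mulVec x := by
    by_cases hx : x = 0
    · simp [hx]
    have hxn : 0 < ‖x‖ := norm_pos_iff.2 hx
    have := hmin (show ‖x‖⁻¹ • x ∈ Metric.sphere (0 : Fin n → ℝ) 1 by
      simp [norm_smul, hxn.ne'])
    simp only [Set.mem_ofPred_eq, mulVec_smul, dotProduct_smul, smul_dotProduct, smul_eq_mul] at this
    rw [← hmdef] at this
    calc m * ‖x‖ ^ 2 ≤ (‖x‖⁻¹ * (‖x‖⁻¹ * (x ⬝ᵥ A.mulVec x))) * ‖x‖ ^ 2 := by gcongr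
      _ = _ := by field_simp
  calc m / n * ∑ i, x i ^ 2 ≤ m / n * (n * ‖x‖ ^ 2) := by gcongr
    _ = m * ‖x‖ ^ 2 := by field_simp
    _ ≤ _ := h2

lemma qf_re {n : ℕ} (A : Matrix (Fin n) (Fin n) ℝ) (z : Fin n → ℂ) :
    (qf A z).re = (fun i => (z i).re) ⬝ᵥ A.mulVec (fun i => (z i).re) +
      (fun i => (z i).im) ⬝ᵥ A.mulVec (fun i => (z i).im) := by
  rw [dot_mulVec_eq, dot_mulVec_eq, qf]
  simp [← Finset.sum_add_distrib, mul_add]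

lemma PD.integrable {n : ℕ} {A : Matrix (Fin n) (Fin n) ℝ} (hA : PD A) :
    Integrable (fun z : Fin n → ℂ => Complex.exp (-(qf A z))) (Measure.pi fun _ => kap) := by
  obtain ⟨c, hc, hlow⟩ := hA.lower
  have h1 : Integrable (fun z : ℂ => Real.exp (-c * ‖z‖ ^ 2)) kap := by
    have h := gauss1_int hc 0 0
    have h0 : Integrable (fun z : ℂ => Complex.exp (-((c : ℂ) * (z * conj z) + z * 0 + conj z * 0))) := by
      by_contra H
      rw [integral_undef H] at h
      have hc' : (c : ℂ) ≠ 0 := by exact_mod_cast hc.ne'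
      have hp : (Real.pi : ℂ) ≠ 0 := by exact_mod_cast Real.pi_ne_zero
      refine mul_ne_zero (div_ne_zero hp hc') (Complex.exp_ne_zero _) h.symm
    have h2 := h0.norm
    have h3 : Integrable (fun z : ℂ => Real.exp (-c * ‖z‖ ^ 2)) := by
      refine h2.congr (Filter.Eventually.of_forall fun z => ?_)
      simp only [Complex.norm_exp, mul_zero, add_zero, Complex.mul_conj, Complex.normSq_eq_norm_sq]
      congr 1
      rw [Complex.neg_re, ← Complex.ofReal_mul, Complex.ofReal_re]
      ring
    unfold kap
    exact h3.smul_measure_nnreal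
  have h2 := Integrable.fintype_prod (ι := Fin n) (f := fun _ (z : ℂ) => Real.exp (-c * ‖z‖ ^ 2))
    (μ := fun _ => kap) (fun _ => h1)
  refine h2.mono (by have := qf_cont A; fun_prop) (Filter.Eventually.of_forall fun z => ?_)
  rw [Complex.norm_exp, ← Real.exp_sum, Real.norm_eq_abs, Real.abs_exp]
  apply Real.exp_le_exp.2
  rw [Complex.neg_re, qf_re, ← Finset.mul_sum]
  have e : ∑ i, ‖z i‖ ^ 2 = ∑ i, (z i).re ^ 2 + ∑ i, (z i).im ^ 2 := by
    rw [← Finset.sum_add_distrib]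
    refine Finset.sum_congr rfl fun i _ => ?_
    rw [← Complex.normSq_eq_norm_sq, Complex.normSq_apply]; ring
  have := hlow fun i => (z i).re
  have := hlow fun i => (z i).im
  rw [e]
  linarith

noncomputable def schur {n : ℕ} (A : Matrix (Fin (n+1)) (Fin (n+1)) ℝ) : Matrix (Fin n) (Fin n) ℝ :=
  fun i j => A i.succ j.succ - A i.succ 0 * A 0 j.succ / A 0 0

lemma PD.zero_zero {n : ℕ} {A : Matrix (Fin (n+1)) (Fin (n+1)) ℝ} (hA : PD A) : 0 < A 0 0 := by
  have := hA (Pi.single 0 1) (by simp)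
  simpa using this

lemma schur_det {n : ℕ} (A : Matrix (Fin (n+1)) (Fin (n+1)) ℝ) (h : A 0 0 ≠ 0) :
    A.det = A 0 0 * (schur A).det := by
  let B : Matrix (Fin (n+1)) (Fin (n+1)) ℝ := fun i j =>
    Fin.cases (A 0 j) (fun i => A i.succ j - A i.succ 0 * A 0 j / A 0 0) i
  have hAB : A.det = B.det := by
    refine det_eq_of_forall_row_eq_smul_add_const
      (fun i => Fin.cases 0 (fun i => A i.succ 0 / A 0 0) i) 0 rfl ?_
    intro i j
    refine Fin.cases ?_ (fun i => ?_) i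
    · simp [B]
    · simp only [B, Fin.cases_succ, Fin.cases_zero]
      ring
  rw [hAB, det_succ_column_zero, Fin.sum_univ_succ]
  have h0 : ∀ i : Fin n, B i.succ 0 = 0 := by
    intro i
    simp only [B, Fin.cases_succ]
    field_simp
    ring
  simp only [h0]
  have h1 : B.submatrix (Fin.succAbove 0) Fin.succ = schur A := by
    ext i j
    rw [Matrix.submatrix_apply, Fin.succAbove_zero]
    simp [B, schur]
  rw [h1]
  simp [B]

lemma PD.schur {n : ℕ} {A : Matrix (Fin (n+1)) (Fin (n+1)) ℝ} (hA : PD A) : PD (schur A) := by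
  intro x hx
  have ha := hA.zero_zero
  set t : ℝ := -(∑ j, A 0 j.succ * x j) / A 0 0 with ht
  have h := hA (Fin.cons t x) (by
    intro h0
    apply hx
    ext i
    have := congrFun h0 i.succ
    simpa using this)
  rw [dot_mulVec_eq] at h ⊢
  simp only [Fin.sum_univ_succ, Fin.cons_zero, Fin.cons_succ, Finset.sum_add_distrib] at h
  have e1 : ∑ i : Fin n, ∑ j : Fin n, _root_.schur A i j * (x i * x j) =
      ∑ i : Fin n, ∑ j : Fin n, A i.succ j.succ * (x i * x j) -
        (∑ i : Fin n, A i.succ 0 * x i) * (∑ j, A 0 j.succ * x j) / A 0 0 := by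
    rw [Finset.sum_mul_sum, Finset.sum_div, ← Finset.sum_sub_distrib]
    refine Finset.sum_congr rfl fun i _ => ?_
    rw [Finset.sum_div, ← Finset.sum_sub_distrib]
    refine Finset.sum_congr rfl fun j _ => ?_
    simp only [_root_.schur]
    ring
  have e2 : ∑ j : Fin n, A 0 j.succ * (t * x j) = t * ∑ j, A 0 j.succ * x j := by
    rw [Finset.mul_sum]; exact Finset.sum_congr rfl fun j _ => by ring
  have e3 : ∑ i : Fin n, A i.succ 0 * (x i * t) = t * ∑ i, A i.succ 0 * x i := by
    rw [Finset.mul_sum]; exact Finset.sum_congr rfl fun j _ => by ring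
  rw [e2, e3] at h
  rw [e1]
  convert h using 1
  rw [ht]
  field_simp
  ring

lemma qf_cons {n : ℕ} (A : Matrix (Fin (n+1)) (Fin (n+1)) ℝ) (w : ℂ) (z : Fin n → ℂ) :
    qf A (Fin.cons w z) = ((A 0 0 : ℂ) * (w * conj w) + w * (∑ j, (A 0 j.succ : ℂ) * conj (z j)) +
      conj w * (∑ i, (A i.succ 0 : ℂ) * z i)) + ∑ i, ∑ j, (A i.succ j.succ : ℂ) * (z i * conj (z j)) := by
  simp only [qf, Fin.sum_univ_succ, Fin.cons_zero, Fin.cons_succ, Finset.sum_add_distrib,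
    Finset.mul_sum]
  have e2 : ∑ j : Fin n, (A 0 j.succ : ℂ) * (w * conj (z j)) =
      ∑ j : Fin n, w * ((A 0 j.succ : ℂ) * conj (z j)) :=
    Finset.sum_congr rfl fun j _ => by ring
  have e3 : ∑ i : Fin n, (A i.succ 0 : ℂ) * (z i * conj w) =
      ∑ i : Fin n, conj w * ((A i.succ 0 : ℂ) * z i) :=
    Finset.sum_congr rfl fun j _ => by ring
  rw [e2, e3]
  ring

lemma qf_schur {n : ℕ} (A : Matrix (Fin (n+1)) (Fin (n+1)) ℝ) (z : Fin n → ℂ) :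
    qf (schur A) z = ∑ i, ∑ j, (A i.succ j.succ : ℂ) * (z i * conj (z j)) -
      (∑ i, (A i.succ 0 : ℂ) * z i) * (∑ j, (A 0 j.succ : ℂ) * conj (z j)) / (A 0 0 : ℂ) := by
  rw [Finset.sum_mul_sum, Finset.sum_div, ← Finset.sum_sub_distrib, qf]
  refine Finset.sum_congr rfl fun i _ => ?_
  rw [Finset.sum_div, ← Finset.sum_sub_distrib]
  refine Finset.sum_congr rfl fun j _ => ?_
  simp only [schur]
  push_cast
  ring

lemma gauss_int : ∀ {n : ℕ} {A : Matrix (Fin n) (Fin n) ℝ} (_ : PD A),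
    ∫ z, Complex.exp (-(qf A z)) ∂(Measure.pi fun _ : Fin n => kap) =
      (2 * Real.pi : ℂ) ^ n / (A.det : ℂ)
  | 0, A, _ => by simp [qf, Measure.real]
  | n + 1, A, hA => by
    have ha := hA.zero_zero
    have hgi := hA.integrable
    have hmp := (measurePreserving_piFinSuccAbove (fun _ : Fin (n+1) => kap) 0).symm
    rw [← hmp.integral_comp (MeasurableEquiv.measurableEmbedding _)]
    have hgi' := (hmp.integrable_comp_emb (MeasurableEquiv.measurableEmbedding _)).2 hgi
    rw [integral_prod_symm (fun x => Complex.exp (-qf A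
      ((MeasurableEquiv.piFinSuccAbove (fun x => ℂ) 0).symm x))) hgi']
    have e : ∀ (w : ℂ) (z : Fin n → ℂ),
      (MeasurableEquiv.piFinSuccAbove (fun _ : Fin (n+1) => ℂ) 0).symm (w, z) = Fin.cons w z := by
      intro w z
      simp [MeasurableEquiv.piFinSuccAbove, Fin.insertNthEquiv]
    have e1 : ∀ z : Fin n → ℂ, ∫ w, Complex.exp (-(qf A
        ((MeasurableEquiv.piFinSuccAbove (fun _ : Fin (n+1) => ℂ) 0).symm (w, z)))) ∂kap =
        (2 * Real.pi / A 0 0 : ℂ) * Complex.exp (-(qf (schur A) z)) := by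
      intro z
      simp_rw [e, qf_cons, neg_add _ (∑ i, ∑ j, (A i.succ j.succ : ℂ) * (z i * conj (z j))),
        Complex.exp_add]
      rw [integral_mul_const, kap, integral_smul_nnreal_measure, gauss1_int ha, qf_schur]
      rw [neg_sub, sub_eq_add_neg, Complex.exp_add, NNReal.smul_def, Complex.real_smul]
      push_cast
      ring
    simp_rw [e1]
    rw [integral_const_mul, gauss_int hA.schur, schur_det A ha.ne', pow_succ]
    push_cast
    have ha' : (A 0 0 : ℂ) ≠ 0 := by exact_mod_cast ha.ne'
    rw [div_mul_div_comm, mul_comm ((2 * Real.pi : ℂ) ^ n)]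

lemma PD.det_ne {n : ℕ} {A : Matrix (Fin n) (Fin n) ℝ} (hA : PD A) : A.det ≠ 0 := by
  intro h
  obtain ⟨v, hv, hv0⟩ := Matrix.exists_mulVec_eq_zero_iff.2 h
  have := hA v hv
  simp [hv0] at this

lemma PD.inv_add {n : ℕ} {A : Matrix (Fin n) (Fin n) ℝ} (hA : PD A) {lam : Fin n → ℝ}
    (hl : ∀ i, 0 ≤ lam i) : PD (A⁻¹ + diagonal lam) := by
  intro x hx
  have hu : IsUnit A.det := isUnit_iff_ne_zero.2 hA.det_ne
  have hxy : A.mulVec (A⁻¹.mulVec x) = x := by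
    rw [mulVec_mulVec, mul_nonsing_inv _ hu, one_mulVec]
  have hy : A⁻¹.mulVec x ≠ 0 := by
    intro h0
    rw [h0, mulVec_zero] at hxy
    exact hx hxy.symm
  have h1 := hA _ hy
  rw [hxy] at h1
  rw [add_mulVec, dotProduct_add, dotProduct_comm]
  have h2 : 0 ≤ x ⬝ᵥ (diagonal lam).mulVec x := by
    simp only [dotProduct, mulVec_diagonal]
    refine Finset.sum_nonneg fun i _ => ?_
    have := mul_nonneg (hl i) (mul_self_nonneg (x i))
    linarith
  linarith

lemma qf_add_diag {n : ℕ} (A : Matrix (Fin n) (Fin n) ℝ) (lam : Fin n → ℝ) (z : Fin n → ℂ) :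
    qf (A + diagonal lam) z = qf A z + ∑ i, (lam i : ℂ) * (z i * conj (z i)) := by
  simp only [qf, ← Finset.sum_add_distrib]
  refine Finset.sum_congr rfl fun i _ => ?_
  simp [Matrix.add_apply, add_mul, Finset.sum_add_distrib, Matrix.diagonal_apply, ite_mul,
    apply_ite (Complex.ofReal)]

/-- The exponential function on the orthant. -/
noncomputable def lapExp {n : ℕ} (lam : Fin n → NNReal) : BoundedContinuousFunction (Fin n → NNReal) ℝ :=
  BoundedContinuousFunction.ofNormedAddCommGroup
    (fun x => Real.exp (-(∑ i, (lam i : ℝ) * (x i : ℝ)))) (by fun_prop) 1 (by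
      intro x
      rw [Real.norm_eq_abs, Real.abs_exp, Real.exp_le_one_iff, neg_nonpos]
      positivity)

lemma lapExp_apply {n : ℕ} (lam x : Fin n → NNReal) :
    lapExp lam x = Real.exp (-(∑ i, (lam i : ℝ) * (x i : ℝ))) := rfl

noncomputable def lapMonoid (n : ℕ) : Submonoid (BoundedContinuousFunction (Fin n → NNReal) ℝ) where
  carrier := Set.range lapExp
  one_mem' := ⟨0, by ext x; simp [lapExp_apply]⟩
  mul_mem' := by
    rintro _ _ ⟨a, rfl⟩ ⟨b, rfl⟩
    refine ⟨a + b, ?_⟩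
    ext x
    simp only [lapExp_apply, BoundedContinuousFunction.coe_mul, Pi.mul_apply, ← Real.exp_add,
      Pi.add_apply, NNReal.coe_add, add_mul, Finset.sum_add_distrib, neg_add]

noncomputable def lapAlg (n : ℕ) : StarSubalgebra ℝ (BoundedContinuousFunction (Fin n → NNReal) ℝ) :=
  { Algebra.adjoin ℝ (lapMonoid n : Set (BoundedContinuousFunction (Fin n → NNReal) ℝ)) with
    star_mem' := by
      intro a ha
      have : star a = a := by ext x; simp
      rw [this]; exact ha }

lemma laplace_unique_nn {n : ℕ} {P P' : Measure (Fin n → NNReal)} [IsFiniteMeasure P]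
    [IsFiniteMeasure P'] (h : ∀ lam, ∫ x, lapExp lam x ∂P = ∫ x, lapExp lam x ∂P') : P = P' := by
  refine ext_of_forall_mem_subalgebra_integral_eq_of_pseudoEMetric_complete_countable
    (𝕜 := ℝ) (A := lapAlg n) ?_ ?_
  · intro x y hxy
    obtain ⟨i, hi⟩ := Function.ne_iff.1 hxy
    refine ⟨lapExp (Pi.single i 1), ⟨(lapExp (Pi.single i 1)).toContinuousMap,
      ⟨lapExp (Pi.single i 1), Algebra.subset_adjoin ⟨_, rfl⟩, rfl⟩, rfl⟩, ?_⟩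
    rw [lapExp_apply, lapExp_apply]
    intro h1
    apply hi
    have := Real.exp_injective h1
    simpa [Pi.single_apply, apply_ite ((↑) : NNReal → ℝ)] using this
  · intro g hg
    have hg' : g ∈ Submodule.span ℝ
        (lapMonoid n : Set (BoundedContinuousFunction (Fin n → NNReal) ℝ)) := by
      rw [← Algebra.adjoin_eq_span_of_subset]
      · exact hg
      · rw [Submonoid.closure_eq]
        exact Submodule.subset_span
    clear hg
    induction hg' using Submodule.span_induction with
    | mem x hx => obtain ⟨lam, rfl⟩ := hx; exact h lam
    | zero => simp
    | add x y hx hy h1 h2 =>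
      simp only [BoundedContinuousFunction.coe_add, Pi.add_apply]
      rw [integral_add (x.integrable _) (y.integrable _), integral_add (x.integrable _) (y.integrable _),
        h1, h2]
    | smul a x hx h1 =>
      simp only [BoundedContinuousFunction.coe_smul]
      rw [integral_smul, integral_smul, h1]

lemma laplace_unique {n : ℕ} {P P' : Measure (Fin n → ℝ)} [IsFiniteMeasure P]
    [IsFiniteMeasure P'] (hP : ∀ᵐ x ∂P, ∀ i, 0 ≤ x i) (hP' : ∀ᵐ x ∂P', ∀ i, 0 ≤ x i)
    (h : ∀ lam : Fin n → ℝ, (∀ i, 0 ≤ lam i) → ∫ x, Real.exp (-(∑ i, lam i * x i)) ∂P =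
      ∫ x, Real.exp (-(∑ i, lam i * x i)) ∂P') : P = P' := by
  let r : (Fin n → ℝ) → (Fin n → NNReal) := fun x i => (x i).toNNReal
  let c : (Fin n → NNReal) → (Fin n → ℝ) := fun x i => x i
  have hr : Measurable r := by fun_prop
  have hc : Measurable c := by fun_prop
  have key : ∀ Q : Measure (Fin n → ℝ), (∀ᵐ x ∂Q, ∀ i, 0 ≤ x i) → (Q.map r).map c = Q := by
    intro Q hQ
    rw [Measure.map_map hc hr]
    have : c ∘ r =ᵐ[Q] id := by
      filter_upwards [hQ] with x hx
      ext i
      simp [c, r, hx i]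
    rw [Measure.map_congr this, Measure.map_id]
  have key2 : ∀ Q : Measure (Fin n → ℝ), (∀ᵐ x ∂Q, ∀ i, 0 ≤ x i) → ∀ lam : Fin n → NNReal,
      ∫ x, lapExp lam x ∂(Q.map r) = ∫ x, Real.exp (-(∑ i, (lam i : ℝ) * x i)) ∂Q := by
    intro Q hQ lam
    rw [integral_map hr.aemeasurable (lapExp lam).continuous.aestronglyMeasurable]
    refine integral_congr_ae ?_
    filter_upwards [hQ] with x hx
    simp [lapExp_apply, r, hx]
  rw [← key P hP, ← key P' hP']
  congr 1
  have : IsFiniteMeasure (P.map r) := Measure.isFiniteMeasure_map _ _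
  have : IsFiniteMeasure (P'.map r) := Measure.isFiniteMeasure_map _ _
  apply laplace_unique_nn
  intro lam
  rw [key2 P hP, key2 P' hP']
  exact h (fun i => (lam i : ℝ)) fun i => (lam i).2

/-- A finite measure on the orthant whose Laplace transform is that of the signed density `f`
is given by the density `f`. -/
lemma law_of_laplace {n : ℕ} {P V : Measure (Fin n → ℝ)} [IsFiniteMeasure P]
    (hP : ∀ᵐ x ∂P, ∀ i, 0 ≤ x i) (hV : ∀ᵐ x ∂V, ∀ i, 0 ≤ x i)
    {f : (Fin n → ℝ) → ℝ} (hfm : Measurable f) (hf : Integrable f V)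
    (h : ∀ lam : Fin n → ℝ, (∀ i, 0 ≤ lam i) → ∫ x, Real.exp (-(∑ i, lam i * x i)) ∂P =
      ∫ x, Real.exp (-(∑ i, lam i * x i)) * f x ∂V) :
    P = V.withDensity fun x => ENNReal.ofReal (f x) := by
  set Vp := V.withDensity fun x => ENNReal.ofReal (f x) with hVp
  set Vm := V.withDensity fun x => ENNReal.ofReal (-f x) with hVm
  have : IsFiniteMeasure Vp := isFiniteMeasure_withDensity_ofReal hf.2
  have : IsFiniteMeasure Vm := isFiniteMeasure_withDensity_ofReal hf.neg.2
  have hVp' : ∀ᵐ x ∂Vp, ∀ i, 0 ≤ x i := (withDensity_absolutelyContinuous _ _).ae_le hV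
  have hVm' : ∀ᵐ x ∂Vm, ∀ i, 0 ≤ x i := (withDensity_absolutelyContinuous _ _).ae_le hV
  have hbd : ∀ Q : Measure (Fin n → ℝ), IsFiniteMeasure Q → (∀ᵐ x ∂Q, ∀ i, 0 ≤ x i) →
      ∀ lam : Fin n → ℝ, (∀ i, 0 ≤ lam i) →
      Integrable (fun x => Real.exp (-(∑ i, lam i * x i))) Q := by
    intro Q _ hQ lam hl
    refine Integrable.of_bound (C := 1) (Measurable.aestronglyMeasurable (by fun_prop)) ?_
    filter_upwards [hQ] with x hx
    rw [Real.norm_eq_abs, Real.abs_exp, Real.exp_le_one_iff, neg_nonpos]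
    exact Finset.sum_nonneg fun i _ => mul_nonneg (hl i) (hx i)
  have hsum : P + Vm = Vp := by
    refine laplace_unique ?_ hVp' ?_
    · rw [ae_add_measure_iff]; exact ⟨hP, hVm'⟩
    intro lam hl
    rw [integral_add_measure (hbd P inferInstance hP lam hl) (hbd Vm inferInstance hVm' lam hl), h lam hl]
    have ip := hbd Vp inferInstance hVp' lam hl
    have im := hbd Vm inferInstance hVm' lam hl
    rw [hVp, integrable_withDensity_iff_integrable_smul' (by fun_prop) (by simp)] at ip
    rw [hVm, integrable_withDensity_iff_integrable_smul' (by fun_prop) (by simp)] at im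
    rw [hVp, hVm, integral_withDensity_eq_integral_toReal_smul (by fun_prop) (by simp),
      integral_withDensity_eq_integral_toReal_smul (by fun_prop) (by simp), ← eq_sub_iff_add_eq,
      ← integral_sub ip im]
    refine integral_congr_ae (Filter.Eventually.of_forall fun x => ?_)
    simp only [ENNReal.toReal_ofReal', smul_eq_mul]
    rw [← sub_mul, mul_comm]
    congr 1
    rcases le_total 0 (f x) with h0 | h0
    · rw [max_eq_left h0, max_eq_right (by linarith)]; ring
    · rw [max_eq_right h0, max_eq_left (by linarith)]; ring
  have hVm0 : Vm = 0 := by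
    have hS : MeasurableSet {x | f x < 0} := measurableSet_lt hfm measurable_const
    have h1 : Vm {x | f x < 0} = 0 := by
      have h2 : Vp {x | f x < 0} = 0 := by
        rw [hVp, withDensity_apply _ hS]
        refine (setLIntegral_congr_fun hS fun x hx => ?_).trans (lintegral_zero)
        exact ENNReal.ofReal_of_nonpos (le_of_lt hx)
      rw [← hsum, Measure.add_apply] at h2
      exact (add_eq_zero.1 h2).2
    have h2 : Vm {x | f x < 0}ᶜ = 0 := by
      rw [hVm, withDensity_apply _ hS.compl]
      refine (setLIntegral_congr_fun hS.compl fun x hx => ?_).trans (lintegral_zero)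
      refine ENNReal.ofReal_of_nonpos ?_
      have : ¬ f x < 0 := hx
      linarith
    rw [← Measure.measure_univ_eq_zero, ← measure_add_measure_compl hS, h1, h2, add_zero]
  rw [hVm0, add_zero] at hsum
  exact hsum

lemma polar_mp (n : ℕ) : MeasurePreserving
    (fun (p : (Fin n → ℝ) × (Fin n → ℝ)) (i : Fin n) => polarPhi (p.1 i, p.2 i))
    ((Measure.pi fun _ => nuL).prod (Measure.pi fun _ => nuT)) (Measure.pi fun _ => kap) := by
  have h1 := (measurePreserving_arrowProdEquivProdArrow ℝ ℝ (Fin n) (fun _ => nuL)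
    (fun _ => nuT)).symm
  have h2 := measurePreserving_pi (fun _ : Fin n => nuL.prod nuT) (fun _ => kap)
    (fun _ => (⟨polarPhi_meas, polar_map⟩ : MeasurePreserving polarPhi (nuL.prod nuT) kap))
  exact h2.comp h1

lemma shift_mp (n : ℕ) : MeasurePreserving (fun (t : Fin n → ℝ) (i : Fin n) => t i + Real.pi)
    (Measure.pi fun _ => nuT)
    (volume.restrict (Set.univ.pi fun _ : Fin n => Set.Ico (0 : ℝ) (2 * Real.pi))) := by
  have h1 : MeasurePreserving (fun t : ℝ => t + Real.pi) nuT
      (volume.restrict (Set.Ico (0 : ℝ) (2 * Real.pi))) := by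
    rw [← Measure.restrict_congr_set (Ioo_ae_eq_Ico (a := (0:ℝ)) (b := 2 * Real.pi))]
    have h := (measurePreserving_add_right (volume : Measure ℝ) Real.pi).restrict_preimage
      (measurableSet_Ioo (a := (0:ℝ)) (b := 2 * Real.pi))
    have e : (fun t : ℝ => t + Real.pi) ⁻¹' Set.Ioo 0 (2 * Real.pi) =
        Set.Ioo (-Real.pi) Real.pi := by
      ext x
      simp only [Set.mem_preimage, Set.mem_Ioo]
      constructor <;> rintro ⟨h1, h2⟩ <;> constructor <;> linarith
    rw [e] at h
    exact h
  rw [volume_pi, Measure.restrict_pi_pi]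
  exact measurePreserving_pi _ _ fun _ => h1

lemma qf_polar {n : ℕ} (A : Matrix (Fin n) (Fin n) ℝ) {l : Fin n → ℝ} (hl : ∀ i, 0 ≤ l i)
    (t : Fin n → ℝ) : -(qf A fun i => polarPhi (l i, t i)) =
      ∑ i, ∑ j, ((-(A i j) : ℝ) : ℂ) * ((Real.sqrt (l i * l j) : ℝ) : ℂ) *
        Complex.exp (Complex.I * (((t i : ℝ) : ℂ) - ((t j : ℝ) : ℂ))) := by
  rw [qf, ← Finset.sum_neg_distrib]
  refine Finset.sum_congr rfl fun i _ => ?_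
  rw [← Finset.sum_neg_distrib]
  refine Finset.sum_congr rfl fun j _ => ?_
  simp only [polarPhi]
  rw [Real.sqrt_mul (hl i), mul_sub, sub_eq_add_neg, Complex.exp_add, map_mul, Complex.conj_ofReal,
    ← Complex.exp_conj, map_mul, Complex.conj_I, Complex.conj_ofReal]
  push_cast
  rw [neg_mul Complex.I]
  ring

lemma permDensity_eq {n : ℕ} (G : Matrix (Fin n) (Fin n) ℝ) {l : Fin n → ℝ} (hl : ∀ i, 0 ≤ l i) :
    permDensity G l = (((2 * Real.pi)⁻¹ : ℝ) ^ n : ℝ) * ((G.det⁻¹ : ℝ) : ℂ) *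
      ∫ t : Fin n → ℝ, Complex.exp (-(qf G⁻¹ fun i => polarPhi (l i, t i)))
        ∂(Measure.pi fun _ => nuT) := by
  rw [permDensity, ← (shift_mp n).map_eq, integral_map (shift_mp n).measurable.aemeasurable]
  · congr 1
    refine integral_congr_ae (Filter.Eventually.of_forall fun t => ?_)
    simp only
    rw [qf_polar _ hl]
    congr 1
    refine Finset.sum_congr rfl fun i _ => Finset.sum_congr rfl fun j _ => ?_
    congr 3
    push_cast
    ring
  · refine Continuous.aestronglyMeasurable ?_
    fun_prop

lemma permDensity_meas {n : ℕ} (G : Matrix (Fin n) (Fin n) ℝ) : Measurable (permDensity G) := by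
  unfold permDensity
  refine Measurable.const_mul ?_ _
  refine StronglyMeasurable.measurable ?_
  refine StronglyMeasurable.integral_prod_right' (f := fun p : (Fin n → ℝ) × (Fin n → ℝ) =>
      Complex.exp (∑ i, ∑ j, ((-(G⁻¹ i j) : ℝ) : ℂ) * ((Real.sqrt (p.1 i * p.1 j) : ℝ) : ℂ) *
        Complex.exp (Complex.I * (((p.2 i : ℝ) : ℂ) - ((p.2 j : ℝ) : ℂ))))) ?_
  refine Continuous.stronglyMeasurable ?_
  fun_prop

lemma nuL_nonneg (n : ℕ) : ∀ᵐ x ∂(Measure.pi fun _ : Fin n => nuL), ∀ i, 0 ≤ x i := by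
  have : (Measure.pi fun _ : Fin n => nuL) =
      volume.restrict (Set.univ.pi fun _ : Fin n => Set.Ioi (0:ℝ)) := by
    rw [volume_pi, Measure.restrict_pi_pi]; rfl
  rw [this]
  filter_upwards [ae_restrict_mem (MeasurableSet.univ_pi fun _ => measurableSet_Ioi)] with x hx i
  exact le_of_lt (hx i trivial)

lemma orthant_eq (n : ℕ) : (volume : Measure (Fin n → ℝ)).restrict {l | ∀ i, 0 ≤ l i} =
    Measure.pi fun _ : Fin n => nuL := by
  have h : {l : Fin n → ℝ | ∀ i, 0 ≤ l i} = Set.univ.pi fun _ : Fin n => Set.Ici (0:ℝ) := by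
    ext x; simp only [Set.mem_ofPred_eq, Set.mem_pi, Set.mem_univ, Set.mem_Ici, true_imp_iff]
  rw [h, volume_pi, Measure.restrict_pi_pi]
  congr 1
  ext1 i
  exact (Measure.restrict_congr_set Ioi_ae_eq_Ici).symm

lemma lap_density {n : ℕ} {G : Matrix (Fin n) (Fin n) ℝ} (hG : PD G) {lam : Fin n → ℝ}
    (hl : ∀ i, 0 ≤ lam i) :
    Integrable (fun l => ((Real.exp (-(∑ i, lam i * l i)) : ℝ) : ℂ) * permDensity G l)
      (Measure.pi fun _ => nuL) ∧
    ∫ l, ((Real.exp (-(∑ i, lam i * l i)) : ℝ) : ℂ) * permDensity G l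
      ∂(Measure.pi fun _ => nuL) = ((((1 + Matrix.diagonal lam * G).det)⁻¹ : ℝ) : ℂ) := by
  have hA := hG.inv_add hl
  set A := G⁻¹ + diagonal lam with hAdef
  have hgi := hA.integrable
  have hgi2 : Integrable (fun p : (Fin n → ℝ) × (Fin n → ℝ) =>
      Complex.exp (-(qf A fun i => polarPhi (p.1 i, p.2 i))))
      ((Measure.pi fun _ => nuL).prod (Measure.pi fun _ => nuT)) :=
    (polar_mp n).integrable_comp_of_integrable hgi
  have hval : ∫ p : (Fin n → ℝ) × (Fin n → ℝ), Complex.exp (-(qf A fun i => polarPhi (p.1 i, p.2 i)))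
      ∂((Measure.pi fun _ => nuL).prod (Measure.pi fun _ => nuT)) =
        (2 * Real.pi : ℂ) ^ n / (A.det : ℂ) := by
    rw [← gauss_int hA, ← (polar_mp n).map_eq, integral_map (polar_mp n).measurable.aemeasurable]
    have := qf_cont A
    exact Continuous.aestronglyMeasurable (by fun_prop)
  set C : ℂ := (((2 * Real.pi)⁻¹ : ℝ) ^ n : ℝ) * ((G.det⁻¹ : ℝ) : ℂ) with hC
  have hae : (fun l => ((Real.exp (-(∑ i, lam i * l i)) : ℝ) : ℂ) * permDensity G l)
      =ᵐ[Measure.pi fun _ => nuL] fun l => C * ∫ t : Fin n → ℝ,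
        Complex.exp (-(qf A fun i => polarPhi (l i, t i))) ∂(Measure.pi fun _ => nuT) := by
    filter_upwards [nuL_nonneg n] with l hl0
    rw [permDensity_eq G hl0, ← hC, mul_left_comm, ← integral_const_mul]
    congr 1
    refine integral_congr_ae (Filter.Eventually.of_forall fun t => ?_)
    simp only
    rw [hAdef, qf_add_diag, Complex.ofReal_exp, ← Complex.exp_add]
    congr 1
    have e : ∀ i, polarPhi (l i, t i) * conj (polarPhi (l i, t i)) = (l i : ℂ) := by
      intro i
      rw [Complex.mul_conj, Complex.normSq_eq_norm_sq]
      simp only [polarPhi]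
      rw [norm_mul, mul_comm Complex.I, Complex.norm_exp_ofReal_mul_I, mul_one, Complex.norm_real,
        Real.norm_eq_abs, sq_abs, Real.sq_sqrt (hl0 i)]
    simp_rw [e]
    push_cast
    ring
  have hdet : (1 + Matrix.diagonal lam * G).det = A.det * G.det := by
    rw [← det_mul, hAdef, add_mul, nonsing_inv_mul _ (isUnit_iff_ne_zero.2 hG.det_ne)]
  constructor
  · rw [integrable_congr hae]
    exact hgi2.integral_prod_left.const_mul C
  · rw [integral_congr_ae hae, integral_const_mul]
    rw [integral_prod _ hgi2] at hval
    rw [hval, hdet, hC]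
    have h1 : (G.det : ℂ) ≠ 0 := by exact_mod_cast hG.det_ne
    have h2 : (A.det : ℂ) ≠ 0 := by exact_mod_cast hA.det_ne
    have h3 : (Real.pi : ℂ) ≠ 0 := by exact_mod_cast Real.pi_ne_zero
    push_cast
    rw [inv_pow]
    field_simp

/-- **Density of 1-permanental vectors.** Let `G` be an `n × n` real matrix with
positive definite symmetric part, and let `ℓ` be a 1-permanental random vector with kernel `G`,
i.e. `E[exp(−⟨λ,ℓ⟩)] = det(I + diag(λ)·G)⁻¹` for all `λ ∈ ℝ₊ⁿ`. Then the law of `ℓ` is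
absolutely continuous with respect to Lebesgue measure on `ℝ₊ⁿ`, with density `permDensity G`. -/
theorem onePermanental_law_eq_withDensity {n : ℕ} (G : Matrix (Fin n) (Fin n) ℝ)
    (hpd : ∀ x : Fin n → ℝ, x ≠ 0 → 0 < x ⬝ᵥ G.mulVec x)
    {Ω : Type} [MeasurableSpace Ω] (μ : Measure Ω) [IsProbabilityMeasure μ]
    (ℓ : Ω → Fin n → ℝ) (hmeas : Measurable ℓ)
    (hpos : ∀ ω i, 0 ≤ ℓ ω i)
    (hlaplace : ∀ lam : Fin n → ℝ, (∀ i, 0 ≤ lam i) →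
      ∫ ω, Real.exp (-(∑ i, lam i * ℓ ω i)) ∂μ =
        ((1 + Matrix.diagonal lam * G).det)⁻¹) :
    Measure.map ℓ μ =
      (volume.restrict {l : Fin n → ℝ | ∀ i, 0 ≤ l i}).withDensity
        (fun l => ENNReal.ofReal (permDensity G l).re) := by
  have hG : PD G := hpd
  rw [orthant_eq]
  have hprob : IsProbabilityMeasure (Measure.map ℓ μ) :=
    Measure.isProbabilityMeasure_map hmeas.aemeasurable
  refine law_of_laplace ?_ (nuL_nonneg n) (Complex.measurable_re.comp (permDensity_meas G)) ?_ ?_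
  · rw [ae_map_iff hmeas.aemeasurable]
    · exact Filter.Eventually.of_forall hpos
    · have : {x : Fin n → ℝ | ∀ i, 0 ≤ x i} = Set.univ.pi fun _ : Fin n => Set.Ici (0:ℝ) := by
        ext x; simp only [Set.mem_ofPred_eq, Set.mem_pi, Set.mem_univ, Set.mem_Ici, true_imp_iff]
      rw [this]
      exact MeasurableSet.univ_pi fun _ => measurableSet_Ici
  · have h := (lap_density hG (lam := 0) (fun _ => le_rfl)).1.re
    simpa using h
  · intro lam hl
    obtain ⟨h1, h2⟩ := lap_density hG hl
    rw [integral_map hmeas.aemeasurable (Measurable.aestronglyMeasurable (by fun_prop)),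
      hlaplace lam hl]
    have h3 := integral_re h1
    rw [h2] at h3
    simp only [RCLike.re_to_complex, Complex.ofReal_re, Complex.re_ofReal_mul] at h3
    exact h3.symm
end

section
/- Let G be an n×n real matrix with positive definite symmetric part, Q := −G⁻¹, S := (Q+Qᵀ)/2, and let λ_min > 0 be the smallest eigenvalue of −S. Let ℓ be a 1-permanental random vector with kernel G. Then for every t ∈ ℝ₊ⁿ, P( ℓᵢ ≥ tᵢ for all i ) ≤ det(G)⁻¹ · λ_min⁻ⁿ · exp(−λ_min · Σᵢ tᵢ). -/
open Matrix MeasureTheory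

namespace PermTail

lemma det_ne_zero_of_pos {n : ℕ} (A : Matrix (Fin n) (Fin n) ℝ)
    (h : ∀ x : Fin n → ℝ, x ≠ 0 → 0 < x ⬝ᵥ A.mulVec x) : A.det ≠ 0 := by
  intro h0
  obtain ⟨v, hv, hv0⟩ := Matrix.exists_mulVec_eq_zero_iff.2 h0
  have := h v hv
  rw [hv0] at this
  simp at this

lemma dotProduct_self_pos {n : ℕ} (x : Fin n → ℝ) (hx : x ≠ 0) : 0 < x ⬝ᵥ x := by
  have h1 : 0 ≤ x ⬝ᵥ x := Finset.sum_nonneg fun i _ => mul_self_nonneg _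
  have h2 : x ⬝ᵥ x ≠ 0 := fun h => hx (dotProduct_self_eq_zero.1 h)
  exact lt_of_le_of_ne h1 h2.symm

lemma det_pos_of_pos {n : ℕ} (A : Matrix (Fin n) (Fin n) ℝ)
    (h : ∀ x : Fin n → ℝ, x ≠ 0 → 0 < x ⬝ᵥ A.mulVec x) : 0 < A.det := by
  let f : ℝ → ℝ := fun s => ((1 - s) • (1 : Matrix (Fin n) (Fin n) ℝ) + s • A).det
  have hf : Continuous f := by
    apply Continuous.matrix_det
    fun_prop
  have hne : ∀ s ∈ Set.Icc (0:ℝ) 1, f s ≠ 0 := by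
    intro s hs
    apply det_ne_zero_of_pos
    intro x hx
    have h1 := h x hx
    have h2 := dotProduct_self_pos x hx
    rw [add_mulVec, smul_mulVec, smul_mulVec, one_mulVec, dotProduct_add, dotProduct_smul,
      dotProduct_smul, smul_eq_mul, smul_eq_mul]
    rcases hs.2.lt_or_eq with h3 | h3
    · have := mul_pos (sub_pos.2 h3) h2
      have := mul_nonneg hs.1 h1.le
      linarith
    · subst h3; simpa using h1
  have h0 : f 0 = 1 := by simp [f]
  have h1 : f 1 = A.det := by simp [f]
  by_contra hcon
  have : (0:ℝ) ∈ Set.Icc (f 1) (f 0) := by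
    rw [h0, h1]; exact ⟨not_lt.1 hcon, zero_le_one⟩
  obtain ⟨s, hs, hs0⟩ := intermediate_value_Icc' zero_le_one hf.continuousOn this
  exact hne s hs hs0

lemma integral_mulVec {n : ℕ} (B : Matrix (Fin n) (Fin n) ℝ) (hB : B.det ≠ 0)
    (g : (Fin n → ℝ) → ℂ) (hg : Continuous g) :
    ∫ x, g (B.mulVec x) = (|B.det|⁻¹ : ℝ) * ∫ x, g x := by
  have h := Real.map_matrix_volume_pi_eq_smul_volume_pi hB
  have h2 := integral_map_of_stronglyMeasurable (μ := volume) (φ := toLin' B)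
    (LinearMap.continuous_of_finiteDimensional _).measurable hg.stronglyMeasurable
  rw [h, integral_smul_measure] at h2
  simp only [toLin'_apply] at h2
  rw [← h2, ENNReal.toReal_ofReal (abs_nonneg _), abs_inv]
  simp

lemma gauss_B {n : ℕ} (B : Matrix (Fin n) (Fin n) ℝ) (hB : B.det ≠ 0) (c : Fin n → ℝ) :
    ∫ x : Fin n → ℝ, Complex.exp (-((B *ᵥ x) ⬝ᵥ (B *ᵥ x) : ℝ) +
        Complex.I * (2 * (c ⬝ᵥ (B *ᵥ x)) : ℝ)) =
      (|B.det|⁻¹ : ℝ) * ((Real.pi : ℂ) ^ (n / 2 : ℂ) * Complex.exp (-(c ⬝ᵥ c : ℝ))) := by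
  have h1 := integral_mulVec B hB (fun v => Complex.exp (-(v ⬝ᵥ v : ℝ) +
        Complex.I * (2 * (c ⬝ᵥ v) : ℝ))) (by
          simp only [dotProduct]
          fun_prop)
  rw [h1]
  congr 1
  have h2 := GaussianFourier.integral_cexp_neg_mul_sum_add (b := 1) (by simp)
    (fun i => Complex.I * 2 * (c i : ℂ))
  rw [div_one, Fintype.card_fin] at h2
  convert h2 using 4
  · simp only [dotProduct]; push_cast
    rw [Finset.mul_sum, Finset.mul_sum, neg_one_mul]
    congr 1
    · simp [pow_two]
    · refine Finset.sum_congr rfl fun i _ => by ring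
  · simp only [dotProduct]; push_cast
    rw [← Finset.sum_neg_distrib, Finset.sum_div]
    refine Finset.sum_congr rfl fun i _ => ?_
    rw [mul_pow, mul_pow, Complex.I_sq]; ring

/-- complex Gaussian density on pairs -/
noncomputable def F {n : ℕ} (A : Matrix (Fin n) (Fin n) ℝ)
    (p : (Fin n → ℝ) × (Fin n → ℝ)) : ℂ :=
  Complex.exp (-(p.1 ⬝ᵥ A *ᵥ p.1 + p.2 ⬝ᵥ A *ᵥ p.2 : ℝ) +
    Complex.I * (p.1 ⬝ᵥ (A - Aᵀ) *ᵥ p.2 : ℝ))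

lemma F_cont {n : ℕ} (A : Matrix (Fin n) (Fin n) ℝ) : Continuous (F A) := by
  unfold F
  fun_prop

lemma F_norm {n : ℕ} (A : Matrix (Fin n) (Fin n) ℝ) (p) :
    ‖F A p‖ = Real.exp (-(p.1 ⬝ᵥ A *ᵥ p.1 + p.2 ⬝ᵥ A *ᵥ p.2)) := by
  rw [F, Complex.norm_exp]
  simp [-Complex.ofReal_add]

lemma F_integrable {n : ℕ} (A : Matrix (Fin n) (Fin n) ℝ) (c : ℝ) (hc : 0 < c)
    (h : ∀ x : Fin n → ℝ, c * (∑ i, x i ^ 2) ≤ x ⬝ᵥ A *ᵥ x) : Integrable (F A) := by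
  have h1 : Integrable (fun x : Fin n → ℝ => ∏ i, Real.exp (-c * x i ^ 2)) :=
    Integrable.fintype_prod (f := fun _ (v : ℝ) => Real.exp (-c * v ^ 2))
      (fun i => integrable_exp_neg_mul_sq hc)
  refine (h1.mul_prod h1).mono (F_cont A).aestronglyMeasurable (Filter.Eventually.of_forall ?_)
  intro p
  rw [F_norm, ← Real.exp_sum, ← Real.exp_sum, ← Real.exp_add, Real.norm_of_nonneg (Real.exp_pos _).le]
  apply Real.exp_le_exp.2
  rw [← Finset.mul_sum, ← Finset.mul_sum]
  linarith [h p.1, h p.2]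

open scoped MatrixOrder in
lemma exists_factor {n : ℕ} (S : Matrix (Fin n) (Fin n) ℝ) (hS : S.PosDef) :
    ∃ B : Matrix (Fin n) (Fin n) ℝ, B.det ≠ 0 ∧ S = Bᵀ * B := by
  obtain ⟨B, hB⟩ := CStarAlgebra.nonneg_iff_eq_star_mul_self.mp hS.posSemidef.nonneg
  have hB' : S = Bᵀ * B := by rw [hB]; rfl
  refine ⟨B, ?_, hB'⟩
  intro h0
  have := hS.det_pos
  rw [hB', det_mul, h0] at this
  simp at this

lemma F_integral {n : ℕ} (A : Matrix (Fin n) (Fin n) ℝ) (c : ℝ) (hc : 0 < c)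
    (h : ∀ x : Fin n → ℝ, c * (∑ i, x i ^ 2) ≤ x ⬝ᵥ A *ᵥ x) :
    ∫ p, F A p = ((Real.pi ^ n * A.det⁻¹ : ℝ) : ℂ) := by
  have hpos : ∀ x : Fin n → ℝ, x ≠ 0 → 0 < x ⬝ᵥ A *ᵥ x := by
    intro x hx
    have h1 := dotProduct_self_pos x hx
    refine lt_of_lt_of_le (mul_pos hc h1) ?_
    have := h x
    simpa only [dotProduct, pow_two] using this
  have hdet := det_pos_of_pos A hpos
  have htr : ∀ x y : Fin n → ℝ, x ⬝ᵥ Aᵀ *ᵥ y = y ⬝ᵥ A *ᵥ x := by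
    intro x y
    rw [mulVec_transpose, dotProduct_comm, dotProduct_mulVec]
  have hS : ((1/2:ℝ) • (A + Aᵀ)).PosDef := by
    refine PosDef.of_dotProduct_mulVec_pos ?_ ?_
    · ext i j; simp [add_comm]; ring
    · intro x hx
      have := hpos x hx
      rw [star_trivial, smul_mulVec, dotProduct_smul, add_mulVec, dotProduct_add, htr, smul_eq_mul]
      linarith
  obtain ⟨B, hB, hSB⟩ := exists_factor _ hS
  have hBu : IsUnit Bᵀ.det := by rw [det_transpose]; exact hB.isUnit
  -- K = (A - Aᵀ)/2 and T solves Bᵀ T = Kᵀ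
  set K : Matrix (Fin n) (Fin n) ℝ := (1/2:ℝ) • (A - Aᵀ) with hK
  have hA : A = Bᵀ * B + K := by
    rw [← hSB, hK]; ext i j; simp; ring
  have hKT : Kᵀ = -K := by rw [hK]; ext i j; simp; ring
  have hAK : A - Aᵀ = (2:ℝ) • K := by rw [hK]; ext i j; simp
  set T : Matrix (Fin n) (Fin n) ℝ := (Bᵀ)⁻¹ * Kᵀ with hT
  have hBT : Bᵀ * T = Kᵀ := by rw [hT, mul_nonsing_inv_cancel_left _ _ hBu]
  have hKxx : ∀ x : Fin n → ℝ, x ⬝ᵥ K *ᵥ x = 0 := by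
    intro x
    have h1 : x ⬝ᵥ Kᵀ *ᵥ x = x ⬝ᵥ K *ᵥ x := by
      rw [mulVec_transpose, dotProduct_comm, dotProduct_mulVec]
    rw [hKT, neg_mulVec, dotProduct_neg] at h1
    linarith
  have hAxx : ∀ x : Fin n → ℝ, x ⬝ᵥ A *ᵥ x = (B *ᵥ x) ⬝ᵥ (B *ᵥ x) := by
    intro x
    rw [hA, add_mulVec, dotProduct_add, hKxx, add_zero, ← mulVec_mulVec, dotProduct_mulVec,
      vecMul_transpose]
  have hcross : ∀ x y : Fin n → ℝ, x ⬝ᵥ (A - Aᵀ) *ᵥ y = 2 * ((T *ᵥ x) ⬝ᵥ (B *ᵥ y)) := by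
    intro x y
    have : K = Tᵀ * B := by
      rw [← transpose_transpose K, ← hBT, transpose_mul, transpose_transpose]
    rw [hAK, smul_mulVec, dotProduct_smul, this, ← mulVec_mulVec, dotProduct_mulVec,
      vecMul_transpose, smul_eq_mul]
  have hC : (B + T).det = A.det / B.det := by
    rw [eq_div_iff hB, mul_comm, ← det_transpose B, ← det_mul, mul_add, hBT, ← det_transpose A]
    congr 1
    conv_rhs => rw [hA]
    simp [transpose_add]
  have hC0 : (B + T).det ≠ 0 := by rw [hC]; exact div_ne_zero hdet.ne' hB
  have hCxx : ∀ x : Fin n → ℝ, ((B + T) *ᵥ x) ⬝ᵥ ((B + T) *ᵥ x) =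
      (B *ᵥ x) ⬝ᵥ (B *ᵥ x) + (T *ᵥ x) ⬝ᵥ (T *ᵥ x) := by
    intro x
    have h0 : (B *ᵥ x) ⬝ᵥ (T *ᵥ x) = 0 := by
      have := hKxx x
      rw [← neg_eq_zero, ← dotProduct_neg, ← neg_mulVec, ← hKT, ← hBT, ← mulVec_mulVec,
        dotProduct_mulVec, vecMul_transpose] at this
      exact this
    rw [add_mulVec, add_dotProduct, dotProduct_add, dotProduct_add, h0,
      dotProduct_comm (T *ᵥ x) (B *ᵥ x), h0]
    ring
  have hint := F_integrable A c hc h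
  rw [Measure.volume_eq_prod] at hint ⊢
  rw [integral_prod _ hint]
  have inner : ∀ x : Fin n → ℝ, ∫ y, F A (x, y) =
      ((|B.det|⁻¹ : ℝ) * ((Real.pi : ℂ) ^ (n / 2 : ℂ))) *
        Complex.exp (-(((B + T) *ᵥ x) ⬝ᵥ ((B + T) *ᵥ x) : ℝ) +
        Complex.I * (2 * ((0 : Fin n → ℝ) ⬝ᵥ ((B + T) *ᵥ x)) : ℝ)) := by
    intro x
    have h1 : ∀ y, F A (x, y) = Complex.exp (-((B *ᵥ x) ⬝ᵥ (B *ᵥ x) : ℝ)) *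
        Complex.exp (-((B *ᵥ y) ⬝ᵥ (B *ᵥ y) : ℝ) +
        Complex.I * (2 * ((T *ᵥ x) ⬝ᵥ (B *ᵥ y)) : ℝ)) := by
      intro y
      rw [F, ← Complex.exp_add]
      simp only [hAxx, hcross]
      congr 1
      push_cast; ring
    simp only [h1]
    rw [integral_const_mul, gauss_B B hB, hCxx, zero_dotProduct]
    have : Complex.exp (-(((B *ᵥ x) ⬝ᵥ (B *ᵥ x) + (T *ᵥ x) ⬝ᵥ (T *ᵥ x) : ℝ) : ℂ) +
        Complex.I * ((2 * 0 : ℝ) : ℂ)) = Complex.exp (-((B *ᵥ x) ⬝ᵥ (B *ᵥ x) : ℝ)) *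
          Complex.exp (-((T *ᵥ x) ⬝ᵥ (T *ᵥ x) : ℝ)) := by
      rw [← Complex.exp_add]; congr 1; push_cast; ring
    rw [this]
    ring
  simp only [inner]
  rw [integral_const_mul, gauss_B (B + T) hC0 0, hC]
  have hpi : ((Real.pi : ℂ) ^ (n / 2 : ℂ)) * ((Real.pi : ℂ) ^ (n / 2 : ℂ)) = (Real.pi : ℂ) ^ n := by
    rw [← Complex.cpow_add _ _ (by exact_mod_cast Real.pi_ne_zero), add_halves,
      Complex.cpow_natCast]
  have habs : |B.det|⁻¹ * |A.det / B.det|⁻¹ = A.det⁻¹ := by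
    rw [abs_div, abs_of_pos hdet]
    have : |B.det| ≠ 0 := abs_ne_zero.2 hB
    field_simp
  rw [zero_dotProduct]
  push_cast [← hpi, ← habs]
  simp
  ring


lemma integral_rpow_mul_pow (lam : ℝ) (hlam : 0 < lam) (k : ℕ) :
    ∫ u in (0:ℝ)..1, u ^ (lam - 1) * u ^ k = (lam + k)⁻¹ := by
  have h1 : ∫ u in (0:ℝ)..1, u ^ (lam - 1) * u ^ k = ∫ u in (0:ℝ)..1, u ^ (lam - 1 + k) := by
    rw [intervalIntegral.integral_of_le zero_le_one, intervalIntegral.integral_of_le zero_le_one]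
    refine setIntegral_congr_fun measurableSet_Ioc fun u hu => ?_
    exact (Real.rpow_add_natCast hu.1.ne' _ _).symm
  have hk : (0:ℝ) ≤ k := Nat.cast_nonneg k
  rw [h1, integral_rpow (Or.inl (by linarith)), Real.one_rpow, Real.zero_rpow (by linarith)]
  rw [sub_zero, one_div]; congr 1; ring

lemma poly_integral (lam : ℝ) (hlam : 0 < lam) (p : Polynomial ℝ) (N : ℕ) (hN : p.natDegree < N) :
    ∫ u in (0:ℝ)..1, u ^ (lam - 1) * p.eval u =
      ∑ k ∈ Finset.range N, p.coeff k * (lam + k)⁻¹ := by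
  simp only [Polynomial.eval_eq_sum_range' hN, Finset.mul_sum]
  have hi : IntervalIntegrable (fun u : ℝ => u ^ (lam - 1)) volume 0 1 :=
    intervalIntegral.intervalIntegrable_rpow' (by linarith)
  rw [intervalIntegral.integral_finsetSum]
  · refine Finset.sum_congr rfl fun k _ => ?_
    rw [← integral_rpow_mul_pow lam hlam k, ← intervalIntegral.integral_const_mul]
    congr 1; ext u; ring
  · intro k _
    exact hi.mul_continuousOn (by fun_prop)

lemma exists_poly (lam : ℝ) (hlam : 0 < lam) (s : ℝ) (hs : 0 < s) (hs1 : s ≤ 1)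
    (ε : ℝ) (hε : 0 < ε) :
    ∃ p : Polynomial ℝ, (∀ u ∈ Set.Icc (0:ℝ) 1, 0 ≤ p.eval u) ∧
      (∀ u ∈ Set.Icc (0:ℝ) s, 1 ≤ p.eval u) ∧
      ∀ N, p.natDegree < N →
        ∑ k ∈ Finset.range N, p.coeff k * (lam + k)⁻¹ ≤ s ^ lam * lam⁻¹ + ε := by
  obtain ⟨s', hss', hs'⟩ : ∃ s', s < s' ∧ s' ^ lam < s ^ lam + lam * ε / 2 := by
    have hc : ContinuousAt (fun x : ℝ => x ^ lam) s := by
      exact Real.continuousAt_rpow_const _ _ (Or.inl hs.ne')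
    have h1 : ∀ᶠ x in nhds s, x ^ lam < s ^ lam + lam * ε / 2 :=
      hc.eventually_lt continuousAt_const (by have := mul_pos hlam hε; linarith)
    have h2 : ∀ᶠ x in nhdsWithin s (Set.Ioi s), x ^ lam < s ^ lam + lam * ε / 2 :=
      h1.filter_mono nhdsWithin_le_nhds
    obtain ⟨x, hx1, hx2⟩ := (h2.and self_mem_nhdsWithin).exists
    exact ⟨x, hx2, hx1⟩
  set η := lam * ε / 4 with hη
  have hη0 : 0 < η := by positivity
  set h : ℝ → ℝ := fun u => max 0 (min 1 (1 - (u - s) / (s' - s))) + η with hh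
  have hd : 0 < s' - s := by linarith
  obtain ⟨p, hp⟩ := exists_polynomial_near_of_continuousOn 0 1 h
    (by rw [hh]; fun_prop) η hη0
  have hh0 : ∀ u, η ≤ h u := fun u => by
    have := le_max_left 0 (min 1 (1 - (u - s) / (s' - s)))
    simp only [hh]; linarith
  have hh1 : ∀ u, h u ≤ 1 + η := fun u => by
    have : max 0 (min 1 (1 - (u - s) / (s' - s))) ≤ 1 := max_le zero_le_one (min_le_left _ _)
    simp only [hh]; linarith
  have hhs : ∀ u, u ≤ s → 1 + η ≤ h u := fun u hu => by
    have h1 : (u - s) / (s' - s) ≤ 0 := div_nonpos_of_nonpos_of_nonneg (by linarith) hd.le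
    have : 1 ≤ max 0 (min 1 (1 - (u - s) / (s' - s))) :=
      le_max_of_le_right (le_min le_rfl (by linarith))
    simp only [hh]; linarith
  have hhs' : ∀ u, s' ≤ u → h u ≤ η := fun u hu => by
    have h1 : 1 ≤ (u - s) / (s' - s) := by rw [le_div_iff₀ hd]; linarith
    have : max 0 (min 1 (1 - (u - s) / (s' - s))) ≤ 0 :=
      max_le le_rfl ((min_le_right _ _).trans (by linarith))
    simp only [hh]; linarith
  refine ⟨p, ?_, ?_, ?_⟩
  · intro u hu
    have := abs_lt.1 (hp u hu)
    linarith [hh0 u]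
  · intro u hu
    have := abs_lt.1 (hp u ⟨hu.1, hu.2.trans hs1⟩)
    linarith [hhs u hu.2]
  · intro N hN
    rw [← poly_integral lam hlam p N hN]
    set m := min s' 1 with hm
    have hm0 : 0 ≤ m := le_min (by linarith) zero_le_one
    have hm1 : m ≤ 1 := min_le_right _ _
    have hr : ∀ a b : ℝ, IntervalIntegrable (fun u : ℝ => u ^ (lam - 1)) volume a b :=
      fun a b => intervalIntegral.intervalIntegrable_rpow' (by linarith)
    have hi : ∀ a b : ℝ, IntervalIntegrable (fun u : ℝ => u ^ (lam - 1) * p.eval u) volume a b :=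
      fun a b => (hr a b).mul_continuousOn (by fun_prop)
    rw [← intervalIntegral.integral_add_adjacent_intervals (hi 0 m) (hi m 1)]
    have e1 : ∫ u in (0:ℝ)..m, u ^ (lam - 1) * p.eval u ≤
        ∫ u in (0:ℝ)..m, u ^ (lam - 1) * (1 + 2 * η) := by
      refine intervalIntegral.integral_mono_on hm0 (hi _ _) ((hr _ _).mul_const _) ?_
      intro u hu
      refine mul_le_mul_of_nonneg_left ?_ (Real.rpow_nonneg hu.1 _)
      have := abs_lt.1 (hp u ⟨hu.1, hu.2.trans hm1⟩)
      linarith [hh1 u]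
    have e2 : ∫ u in m..1, u ^ (lam - 1) * p.eval u ≤
        ∫ u in m..1, u ^ (lam - 1) * (2 * η) := by
      refine intervalIntegral.integral_mono_on_of_le_Ioo hm1 (hi _ _) ((hr _ _).mul_const _) ?_
      intro u hu
      refine mul_le_mul_of_nonneg_left ?_ (Real.rpow_nonneg (hm0.trans hu.1.le) _)
      have := abs_lt.1 (hp u ⟨hm0.trans hu.1.le, hu.2.le⟩)
      have h3 : s' ≤ u := by
        by_contra hcon
        have := (min_lt_iff.1 hu.1)
        rcases this with h | h
        · linarith
        · linarith [hu.2]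
      linarith [hhs' u h3]
    rw [intervalIntegral.integral_mul_const, integral_rpow (Or.inl (by linarith))] at e1 e2
    rw [sub_add_cancel] at e1 e2
    rw [Real.zero_rpow hlam.ne'] at e1
    rw [Real.one_rpow] at e2
    have hml : m ^ lam ≤ s ^ lam + lam * ε / 2 :=
      (Real.rpow_le_rpow hm0 (min_le_left _ _) hlam.le).trans hs'.le
    calc _ ≤ (m ^ lam - 0) / lam * (1 + 2 * η) + (1 - m ^ lam) / lam * (2 * η) := add_le_add e1 e2
      _ = (m ^ lam + 2 * η) / lam := by field_simp; ring
      _ ≤ (s ^ lam + lam * ε / 2 + 2 * η) / lam := by gcongr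
      _ = s ^ lam * lam⁻¹ + ε := by rw [hη]; field_simp; ring

lemma F_add_diag {n : ℕ} (A : Matrix (Fin n) (Fin n) ℝ) (k : Fin n → ℕ)
    (p : (Fin n → ℝ) × (Fin n → ℝ)) :
    F (A + diagonal (fun i => (k i : ℝ))) p =
      F A p * ((∏ i, Real.exp (-(p.1 i ^ 2 + p.2 i ^ 2)) ^ k i : ℝ) : ℂ) := by
  have h1 : (∏ i, Real.exp (-(p.1 i ^ 2 + p.2 i ^ 2)) ^ k i) =
      Real.exp (- ∑ i, (k i : ℝ) * (p.1 i ^ 2 + p.2 i ^ 2)) := by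
    rw [← Finset.sum_neg_distrib, Real.exp_sum]
    refine Finset.prod_congr rfl fun i _ => ?_
    rw [← Real.exp_nat_mul]; congr 1; ring
  have h2 : ∀ x : Fin n → ℝ, x ⬝ᵥ diagonal (fun i => (k i : ℝ)) *ᵥ x = ∑ i, (k i : ℝ) * x i ^ 2 := by
    intro x
    simp only [dotProduct, mulVec_diagonal]
    exact Finset.sum_congr rfl fun i _ => by ring
  rw [h1, Complex.ofReal_exp, F, F, ← Complex.exp_add]
  rw [transpose_add, diagonal_transpose, add_sub_add_right_eq_sub]
  congr 1
  simp only [add_mulVec, dotProduct_add, h2, mul_add, Finset.sum_add_distrib]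
  push_cast
  ring

lemma F_scalar {n : ℕ} (lam : ℝ) (p : (Fin n → ℝ) × (Fin n → ℝ)) :
    F (lam • (1 : Matrix (Fin n) (Fin n) ℝ)) p =
      ((Real.exp (-(lam * ∑ i, p.1 i ^ 2 + lam * ∑ i, p.2 i ^ 2)) : ℝ) : ℂ) := by
  rw [F, Complex.ofReal_exp]
  congr 1
  simp [smul_mulVec, dotProduct, pow_two, Finset.mul_sum, mul_left_comm]

lemma diag_bound {n : ℕ} (A : Matrix (Fin n) (Fin n) ℝ) (c : ℝ)
    (h : ∀ x : Fin n → ℝ, c * (∑ i, x i ^ 2) ≤ x ⬝ᵥ A *ᵥ x) (k : Fin n → ℕ) (x : Fin n → ℝ) :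
    c * (∑ i, x i ^ 2) ≤ x ⬝ᵥ (A + diagonal (fun i => (k i : ℝ))) *ᵥ x := by
  rw [add_mulVec, dotProduct_add]
  have : 0 ≤ x ⬝ᵥ diagonal (fun i => (k i : ℝ)) *ᵥ x := by
    simp only [dotProduct, mulVec_diagonal]
    refine Finset.sum_nonneg fun i _ => ?_
    have : x i * ((k i : ℝ) * x i) = k i * (x i * x i) := by ring
    rw [this]
    exact mul_nonneg (Nat.cast_nonneg _) (mul_self_nonneg _)
  linarith [h x]

/-- The key comparison on sums of monomials. -/
lemma key_bound {n : ℕ} (A : Matrix (Fin n) (Fin n) ℝ) (lam : ℝ) (hlam : 0 < lam)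
    (h : ∀ x : Fin n → ℝ, lam * (∑ i, x i ^ 2) ≤ x ⬝ᵥ A *ᵥ x)
    (P : Finset (Fin n → ℕ)) (c : (Fin n → ℕ) → ℝ)
    (hc : ∀ u : Fin n → ℝ, (∀ i, u i ∈ Set.Icc (0:ℝ) 1) → 0 ≤ ∑ k ∈ P, c k * ∏ i, u i ^ k i) :
    ∑ k ∈ P, c k * (A + diagonal (fun i => (k i : ℝ))).det⁻¹ ≤
      ∑ k ∈ P, c k * ∏ i, (lam + k i)⁻¹ := by
  set L : Matrix (Fin n) (Fin n) ℝ := lam • 1 with hL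
  have hLb : ∀ x : Fin n → ℝ, lam * (∑ i, x i ^ 2) ≤ x ⬝ᵥ L *ᵥ x := by
    intro x
    apply le_of_eq
    simp [hL, smul_mulVec, dotProduct, pow_two, Finset.mul_sum, mul_left_comm]
  have gen : ∀ M : Matrix (Fin n) (Fin n) ℝ,
      (∀ x : Fin n → ℝ, lam * (∑ i, x i ^ 2) ≤ x ⬝ᵥ M *ᵥ x) →
      Integrable (fun p => ∑ k ∈ P, (c k : ℂ) * F (M + diagonal (fun i => (k i : ℝ))) p) ∧
      ∫ p, ∑ k ∈ P, (c k : ℂ) * F (M + diagonal (fun i => (k i : ℝ))) p =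
        ((Real.pi ^ n * ∑ k ∈ P, c k * (M + diagonal (fun i => (k i : ℝ))).det⁻¹ : ℝ) : ℂ) := by
    intro M hM
    have hi : ∀ k ∈ P, Integrable
        (fun p => (c k : ℂ) * F (M + diagonal (fun i => (k i : ℝ))) p) :=
      fun k _ => (F_integrable _ lam hlam (diag_bound M lam hM k)).const_mul _
    refine ⟨integrable_finsetSum _ hi, ?_⟩
    rw [integral_finsetSum _ hi]
    simp only [integral_const_mul]
    rw [Finset.mul_sum, Complex.ofReal_sum]
    refine Finset.sum_congr rfl fun k _ => ?_
    rw [F_integral _ lam hlam (diag_bound M lam hM k)]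
    push_cast; ring
  have fac : ∀ M : Matrix (Fin n) (Fin n) ℝ, ∀ p,
      ∑ k ∈ P, (c k : ℂ) * F (M + diagonal (fun i => (k i : ℝ))) p =
      F M p * ((∑ k ∈ P, c k * ∏ i, Real.exp (-(p.1 i ^ 2 + p.2 i ^ 2)) ^ k i : ℝ) : ℂ) := by
    intro M p
    rw [Complex.ofReal_sum, Finset.mul_sum]
    refine Finset.sum_congr rfl fun k _ => ?_
    rw [F_add_diag, Complex.ofReal_mul]; ring
  obtain ⟨iA, eA⟩ := gen A h
  obtain ⟨iL, eL⟩ := gen L hLb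
  have hdetL : ∀ k : Fin n → ℕ, (L + diagonal (fun i => (k i : ℝ))).det⁻¹ = ∏ i, (lam + k i)⁻¹ := by
    intro k
    rw [hL, smul_one_eq_diagonal, diagonal_add, det_diagonal, Finset.prod_inv_distrib]
  simp only [hdetL] at eL
  have hpi : 0 < Real.pi ^ n := pow_pos Real.pi_pos n
  refine le_of_mul_le_mul_left ?_ hpi
  set W : (Fin n → ℝ) × (Fin n → ℝ) → ℝ := fun p =>
    ∑ k ∈ P, c k * ∏ i, Real.exp (-(p.1 i ^ 2 + p.2 i ^ 2)) ^ k i with hW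
  have hW0 : ∀ p, 0 ≤ W p := by
    intro p
    refine hc (fun i => Real.exp (-(p.1 i ^ 2 + p.2 i ^ 2))) fun i => ⟨(Real.exp_pos _).le, ?_⟩
    rw [Real.exp_le_one_iff]
    have := sq_nonneg (p.1 i)
    have := sq_nonneg (p.2 i)
    linarith
  simp only [fac] at iA eA iL eL
  calc _ ≤ ‖((Real.pi ^ n * ∑ k ∈ P, c k * (A + diagonal (fun i => (k i : ℝ))).det⁻¹ : ℝ) : ℂ)‖ := by
        rw [Complex.norm_real]; exact le_abs_self _
    _ = ‖∫ p, F A p * (W p : ℂ)‖ := by rw [eA]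
    _ ≤ ∫ p, ‖F A p * (W p : ℂ)‖ := norm_integral_le_integral_norm _
    _ ≤ ∫ p, ‖F L p * (W p : ℂ)‖ := by
        refine integral_mono iA.norm iL.norm fun p => ?_
        simp only [norm_mul]
        refine mul_le_mul_of_nonneg_right ?_ (norm_nonneg _)
        rw [F_norm, F_scalar, Complex.norm_real, Real.norm_of_nonneg (Real.exp_pos _).le]
        apply Real.exp_le_exp.2
        linarith [h p.1, h p.2]
    _ = _ := by
        have e1 : ∀ p, F L p * (W p : ℂ) = ((‖F L p * (W p : ℂ)‖ : ℝ) : ℂ) := by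
          intro p
          rw [norm_mul, F_scalar, Complex.norm_real, Complex.norm_real,
            Real.norm_of_nonneg (Real.exp_pos _).le, Real.norm_of_nonneg (hW0 p)]
          push_cast; rfl
        have e2 : ∫ p, F L p * (W p : ℂ) = ((∫ p, ‖F L p * (W p : ℂ)‖ : ℝ) : ℂ) := by
          rw [← integral_complex_ofReal]
          exact integral_congr_ae (Filter.Eventually.of_forall e1)
        rw [eL] at e2
        exact_mod_cast e2.symm

end PermTail

/-- **Subexponential tails of a 1-permanental vector.** Let `G` have positive
definite symmetric part, `Q := −G⁻¹`, `S := (Q+Qᵀ)/2`, and let `λ_min > 0` be the smallest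
eigenvalue of `−S` (characterized via its Rayleigh quotient). If `ℓ` is a 1-permanental random
vector with kernel `G`, then for every `t ∈ ℝ₊ⁿ`,
`P(ℓᵢ ≥ tᵢ ∀i) ≤ det(G)⁻¹ · λ_min⁻ⁿ · exp(−λ_min Σᵢ tᵢ)`. -/
theorem onePermanental_tail_bound {n : ℕ} (G : Matrix (Fin n) (Fin n) ℝ)
    (hpd : ∀ x : Fin n → ℝ, x ≠ 0 → 0 < x ⬝ᵥ G.mulVec x)
    (S : Matrix (Fin n) (Fin n) ℝ)
    (hS : S = (1 / 2 : ℝ) • ((-G⁻¹) + (-G⁻¹)ᵀ))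
    (lammin : ℝ) (hlammin : 0 < lammin)
    (hray : ∀ x : Fin n → ℝ, lammin * (∑ i, x i ^ 2) ≤ x ⬝ᵥ (-S).mulVec x)
    (hatt : ∃ x : Fin n → ℝ, x ≠ 0 ∧ x ⬝ᵥ (-S).mulVec x = lammin * (∑ i, x i ^ 2))
    {Ω : Type} [MeasurableSpace Ω] (μ : Measure Ω) [IsProbabilityMeasure μ]
    (ℓ : Ω → Fin n → ℝ) (hmeas : Measurable ℓ)
    (hpos : ∀ ω i, 0 ≤ ℓ ω i)
    (hlaplace : ∀ lam : Fin n → ℝ, (∀ i, 0 ≤ lam i) →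
      ∫ ω, Real.exp (-(∑ i, lam i * ℓ ω i)) ∂μ =
        ((1 + Matrix.diagonal lam * G).det)⁻¹) :
    ∀ t : Fin n → ℝ, (∀ i, 0 ≤ t i) →
      μ {ω | ∀ i, t i ≤ ℓ ω i} ≤
        ENNReal.ofReal (G.det⁻¹ * lammin⁻¹ ^ n * Real.exp (-(lammin * ∑ i, t i))) := by
  intro t ht
  have hGdet := PermTail.det_pos_of_pos G hpd
  have hA : ∀ x : Fin n → ℝ, lammin * (∑ i, x i ^ 2) ≤ x ⬝ᵥ G⁻¹ *ᵥ x := by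
    intro x
    refine (hray x).trans (le_of_eq ?_)
    have htr : x ⬝ᵥ (G⁻¹)ᵀ *ᵥ x = x ⬝ᵥ G⁻¹ *ᵥ x := by
      rw [mulVec_transpose, dotProduct_comm, dotProduct_mulVec]
    rw [hS, ← smul_neg, smul_mulVec, dotProduct_smul, neg_add, transpose_neg, neg_neg, neg_neg,
      add_mulVec, dotProduct_add, htr, smul_eq_mul]
    ring
  have hdetk : ∀ k : Fin n → ℕ, ((1 + Matrix.diagonal (fun i => (k i : ℝ)) * G).det)⁻¹ =
      G.det⁻¹ * (G⁻¹ + diagonal (fun i => (k i : ℝ))).det⁻¹ := by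
    intro k
    rw [← mul_inv, mul_comm, ← det_mul, add_mul, nonsing_inv_mul _ hGdet.ne'.isUnit]
  have main : ∀ ε : ℝ, 0 < ε → μ.real {ω | ∀ i, t i ≤ ℓ ω i} ≤
      G.det⁻¹ * ∏ i, (Real.exp (-t i) ^ lammin * lammin⁻¹ + ε) := by
    intro ε hε
    have hex := fun i => PermTail.exists_poly lammin hlammin (Real.exp (-t i)) (Real.exp_pos _)
      (Real.exp_le_one_iff.2 (by linarith [ht i])) ε hε
    choose p hp0 hp1 hpint using hex
    obtain ⟨N, hN⟩ : ∃ N, ∀ i, (p i).natDegree < N :=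
      ⟨(∑ i, (p i).natDegree) + 1, fun i => Nat.lt_succ_of_le
        (Finset.single_le_sum (f := fun i => (p i).natDegree) (fun _ _ => Nat.zero_le _)
          (Finset.mem_univ i))⟩
    set P : Finset (Fin n → ℕ) := Fintype.piFinset (fun _ => Finset.range N) with hP
    set c : (Fin n → ℕ) → ℝ := fun k => ∏ i, (p i).coeff (k i) with hc
    have hprod : ∀ u : Fin n → ℝ, ∏ i, (p i).eval (u i) = ∑ k ∈ P, c k * ∏ i, u i ^ k i := by
      intro u
      simp only [fun i => Polynomial.eval_eq_sum_range' (hN i) (u i)]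
      rw [Finset.prod_univ_sum]
      exact Finset.sum_congr rfl fun k _ => Finset.prod_mul_distrib
    have hprodL : ∏ i, ∑ k ∈ Finset.range N, (p i).coeff k * (lammin + k)⁻¹ =
        ∑ k ∈ P, c k * ∏ i, (lammin + k i)⁻¹ := by
      rw [Finset.prod_univ_sum]
      exact Finset.sum_congr rfl fun k _ => Finset.prod_mul_distrib
    have hkey := PermTail.key_bound G⁻¹ lammin hlammin hA P c (fun u hu => by
      rw [← hprod]
      exact Finset.prod_nonneg fun i _ => hp0 i _ (hu i))
    have hmi : ∀ i, Measurable fun ω => ℓ ω i := fun i => (measurable_pi_apply i).comp hmeas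
    have hset : MeasurableSet {ω | ∀ i, t i ≤ ℓ ω i} := by
      rw [Set.ofPred_forall]
      exact MeasurableSet.iInter fun i => measurableSet_le measurable_const (hmi i)
    have hmono : ∀ (k : Fin n → ℕ) ω, ∏ i, Real.exp (-ℓ ω i) ^ k i =
        Real.exp (-(∑ i, (k i : ℝ) * ℓ ω i)) := by
      intro k ω
      rw [← Finset.sum_neg_distrib, Real.exp_sum]
      refine Finset.prod_congr rfl fun i _ => ?_
      rw [← Real.exp_nat_mul]; congr 1; ring
    have hint : ∀ k : Fin n → ℕ, Integrable (fun ω => Real.exp (-(∑ i, (k i : ℝ) * ℓ ω i))) μ := by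
      intro k
      refine Integrable.of_bound (C := 1) ?_ (Filter.Eventually.of_forall fun ω => ?_)
      · apply Measurable.aestronglyMeasurable
        fun_prop
      · rw [Real.norm_of_nonneg (Real.exp_pos _).le, Real.exp_le_one_iff, neg_nonpos]
        exact Finset.sum_nonneg fun i _ => mul_nonneg (Nat.cast_nonneg _) (hpos ω i)
    have hU : ∀ ω, ∏ i, (p i).eval (Real.exp (-ℓ ω i)) =
        ∑ k ∈ P, c k * Real.exp (-(∑ i, (k i : ℝ) * ℓ ω i)) := by
      intro ω
      rw [hprod]
      simp only [hmono]
    have hUint : Integrable (fun ω => ∏ i, (p i).eval (Real.exp (-ℓ ω i))) μ := by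
      simp only [hU]
      exact integrable_finsetSum _ fun k _ => (hint k).const_mul _
    have hUval : ∫ ω, ∏ i, (p i).eval (Real.exp (-ℓ ω i)) ∂μ =
        G.det⁻¹ * ∑ k ∈ P, c k * (G⁻¹ + diagonal (fun i => (k i : ℝ))).det⁻¹ := by
      simp only [hU]
      rw [integral_finsetSum _ fun k _ => (hint k).const_mul _, Finset.mul_sum]
      refine Finset.sum_congr rfl fun k _ => ?_
      rw [integral_const_mul, hlaplace (fun i => (k i : ℝ)) (fun i => Nat.cast_nonneg _), hdetk]
      ring
    have hu01 : ∀ ω i, Real.exp (-ℓ ω i) ∈ Set.Icc (0:ℝ) 1 := fun ω i =>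
      ⟨(Real.exp_pos _).le, Real.exp_le_one_iff.2 (by linarith [hpos ω i])⟩
    calc μ.real {ω | ∀ i, t i ≤ ℓ ω i}
        = ∫ ω, Set.indicator {ω | ∀ i, t i ≤ ℓ ω i} (fun _ => (1:ℝ)) ω ∂μ := by
          rw [integral_indicator_const _ hset]; simp
      _ ≤ ∫ ω, ∏ i, (p i).eval (Real.exp (-ℓ ω i)) ∂μ := by
          refine integral_mono ((integrable_const 1).indicator hset) hUint fun ω => ?_
          by_cases hω : ω ∈ {ω | ∀ i, t i ≤ ℓ ω i}
          · rw [Set.indicator_of_mem hω]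
            have h1 : ∏ _i : Fin n, (1:ℝ) ≤ ∏ i, (p i).eval (Real.exp (-ℓ ω i)) := by
              refine Finset.prod_le_prod (fun _ _ => zero_le_one) fun i _ => ?_
              exact hp1 i _ ⟨(Real.exp_pos _).le, Real.exp_le_exp.2 (neg_le_neg (hω i))⟩
            simpa using h1
          · rw [Set.indicator_of_notMem hω]
            exact Finset.prod_nonneg fun i _ => hp0 i _ (hu01 ω i)
      _ = G.det⁻¹ * ∑ k ∈ P, c k * (G⁻¹ + diagonal (fun i => (k i : ℝ))).det⁻¹ := hUval
      _ ≤ G.det⁻¹ * ∑ k ∈ P, c k * ∏ i, (lammin + k i)⁻¹ :=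
          mul_le_mul_of_nonneg_left hkey (inv_nonneg.2 hGdet.le)
      _ = G.det⁻¹ * ∏ i, ∑ k ∈ Finset.range N, (p i).coeff k * (lammin + k)⁻¹ := by rw [hprodL]
      _ ≤ _ := by
          refine mul_le_mul_of_nonneg_left ?_ (inv_nonneg.2 hGdet.le)
          refine Finset.prod_le_prod (fun i _ => ?_) (fun i _ => hpint i N (hN i))
          rw [← PermTail.poly_integral lammin hlammin (p i) N (hN i)]
          refine intervalIntegral.integral_nonneg zero_le_one fun u hu => ?_
          exact mul_nonneg (Real.rpow_nonneg hu.1 _) (hp0 i u hu)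
  have hlim : Filter.Tendsto
      (fun ε : ℝ => G.det⁻¹ * ∏ i, (Real.exp (-t i) ^ lammin * lammin⁻¹ + ε))
      (nhdsWithin 0 (Set.Ioi 0))
      (nhds (G.det⁻¹ * ∏ i, (Real.exp (-t i) ^ lammin * lammin⁻¹ + 0))) := by
    have hcont : Continuous
        (fun ε : ℝ => G.det⁻¹ * ∏ i, (Real.exp (-t i) ^ lammin * lammin⁻¹ + ε)) := by fun_prop
    exact (hcont.tendsto 0).mono_left nhdsWithin_le_nhds
  have hfin := ge_of_tendsto hlim (Filter.eventually_of_mem self_mem_nhdsWithin main)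
  have heq : G.det⁻¹ * ∏ i, (Real.exp (-t i) ^ lammin * lammin⁻¹ + 0) =
      G.det⁻¹ * lammin⁻¹ ^ n * Real.exp (-(lammin * ∑ i, t i)) := by
    have h1 : Real.exp (-(lammin * ∑ i, t i)) = ∏ i, Real.exp (-t i) ^ lammin := by
      rw [Finset.mul_sum, ← Finset.sum_neg_distrib, Real.exp_sum]
      refine Finset.prod_congr rfl fun i _ => ?_
      rw [← Real.exp_mul]; congr 1; ring
    simp only [add_zero]
    rw [h1, Finset.prod_mul_distrib, Finset.prod_const, Finset.card_univ, Fintype.card_fin]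
    ring
  rw [heq] at hfin
  rw [← ofReal_measureReal (measure_ne_top μ _)]
  exact ENNReal.ofReal_le_ofReal hfin
end

section
/- Let P be an n×n irreducible stochastic matrix (entries nonnegative, each row sums to 1, and for all i,j there exists k ≥ 1 with (Pᵏ)_{ij} > 0), with stationary distribution π (πᵀP = πᵀ, πᵢ > 0, Σᵢπᵢ = 1). Let Π = diag(π) and Q := Π(P − I). Let h ∈ ℝ₊ⁿ with Σᵢ hᵢ > 0. Then the matrix diag(h) − Q has positive definite symmetric part: xᵀ(diag(h) − Q)x > 0 for every nonzero x ∈ ℝⁿ. Consequently diag(h) − Q is invertible and Gₕ := (diag(h) − Q)⁻¹ also has positive definite symmetric part. -/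
open Matrix

theorem quad_identity {n : ℕ} (P : Matrix (Fin n) (Fin n) ℝ)
    (hProw : ∀ i, ∑ j, P i j = 1) (pr : Fin n → ℝ)
    (hstat : Matrix.vecMul pr P = pr) (h x : Fin n → ℝ) :
    x ⬝ᵥ (Matrix.diagonal h - Matrix.diagonal pr * (P - 1)).mulVec x =
      ∑ i, h i * x i ^ 2 + (1 / 2) * ∑ i, ∑ j, pr i * P i j * (x i - x j) ^ 2 := by
  have hst : ∀ j, ∑ i, pr i * P i j = pr j := fun j => by
    simpa [Matrix.vecMul, dotProduct] using congrFun hstat j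
  have e1 : ∑ i, ∑ j, pr i * P i j * x i ^ 2 = ∑ i, pr i * x i ^ 2 := by
    refine Finset.sum_congr rfl fun i _ => ?_
    rw [← Finset.sum_mul, ← Finset.mul_sum, hProw, mul_one]
  have e2 : ∑ i, ∑ j, pr i * P i j * x j ^ 2 = ∑ i, pr i * x i ^ 2 := by
    rw [Finset.sum_comm]
    refine Finset.sum_congr rfl fun j _ => ?_
    rw [← Finset.sum_mul, hst]
  have e3 : ∑ i, ∑ j, pr i * P i j * (x i - x j) ^ 2 =
      ∑ i, pr i * x i ^ 2 + ∑ i, pr i * x i ^ 2 - 2 * ∑ i, ∑ j, pr i * P i j * (x i * x j) := by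
    nth_rewrite 1 [← e1]
    rw [← e2]
    simp only [Finset.mul_sum, ← Finset.sum_add_distrib, ← Finset.sum_sub_distrib]
    refine Finset.sum_congr rfl fun i _ => Finset.sum_congr rfl fun j _ => ?_
    ring
  rw [e3, Matrix.sub_mulVec, ← Matrix.mulVec_mulVec, Matrix.sub_mulVec, Matrix.one_mulVec]
  have e4 : ∑ i, ∑ j, pr i * P i j * (x i * x j) = ∑ i, pr i * x i * (P *ᵥ x) i := by
    refine Finset.sum_congr rfl fun i _ => ?_
    simp only [Matrix.mulVec, dotProduct, Finset.mul_sum]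
    refine Finset.sum_congr rfl fun j _ => ?_
    ring
  rw [e4]
  have e5 : ∀ a b c : ℝ, a + 1 / 2 * (b + b - 2 * c) = a + b - c := by intros; ring
  rw [e5, ← Finset.sum_add_distrib, ← Finset.sum_sub_distrib]
  simp only [dotProduct]
  refine Finset.sum_congr rfl fun i _ => ?_
  simp only [Pi.sub_apply, Matrix.mulVec_diagonal]
  ring

/-- **Markovian kernels have positive definite symmetric part.** Let `P` be an
irreducible stochastic matrix with stationary distribution `π`, let `Π = diag(π)`,
`Q := Π(P − I)`, and let `h ∈ ℝ₊ⁿ` with `Σᵢ hᵢ > 0`. Then `diag(h) − Q` has positive definite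
symmetric part; consequently it is invertible and `Gₕ := (diag(h) − Q)⁻¹` also has positive
definite symmetric part. -/
theorem markov_laplacian_posDef_symmetric_part {n : ℕ} (P : Matrix (Fin n) (Fin n) ℝ)
    (hPnn : ∀ i j, 0 ≤ P i j) (hProw : ∀ i, ∑ j, P i j = 1)
    (hirr : ∀ i j, ∃ k : ℕ, 1 ≤ k ∧ 0 < (P ^ k) i j)
    (pr : Fin n → ℝ) (hprpos : ∀ i, 0 < pr i) (hprsum : ∑ i, pr i = 1)
    (hstat : Matrix.vecMul pr P = pr)
    (h : Fin n → ℝ) (hh : ∀ i, 0 ≤ h i) (hhsum : 0 < ∑ i, h i) :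
    (∀ x : Fin n → ℝ, x ≠ 0 →
      0 < x ⬝ᵥ (Matrix.diagonal h - Matrix.diagonal pr * (P - 1)).mulVec x) ∧
    IsUnit (Matrix.diagonal h - Matrix.diagonal pr * (P - 1)).det ∧
    (∀ x : Fin n → ℝ, x ≠ 0 →
      0 < x ⬝ᵥ ((Matrix.diagonal h - Matrix.diagonal pr * (P - 1))⁻¹).mulVec x) := by
  have hpos : ∀ x : Fin n → ℝ, x ≠ 0 →
      0 < x ⬝ᵥ (Matrix.diagonal h - Matrix.diagonal pr * (P - 1)).mulVec x := by
    intro x hx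
    rw [quad_identity P hProw pr hstat h x]
    have t1 : ∀ i, 0 ≤ h i * x i ^ 2 := fun i => mul_nonneg (hh i) (sq_nonneg _)
    have t2 : ∀ i j, 0 ≤ pr i * P i j * (x i - x j) ^ 2 := fun i j =>
      mul_nonneg (mul_nonneg (hprpos i).le (hPnn i j)) (sq_nonneg _)
    have s1 : 0 ≤ ∑ i, h i * x i ^ 2 := Finset.sum_nonneg fun i _ => t1 i
    have s2 : 0 ≤ ∑ i, ∑ j, pr i * P i j * (x i - x j) ^ 2 :=
      Finset.sum_nonneg fun i _ => Finset.sum_nonneg fun j _ => t2 i j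
    by_contra hcon
    have z1 : ∑ i, h i * x i ^ 2 = 0 := by linarith
    have z2 : ∑ i, ∑ j, pr i * P i j * (x i - x j) ^ 2 = 0 := by linarith
    have a1 : ∀ i, h i * x i ^ 2 = 0 := fun i =>
      (Finset.sum_eq_zero_iff_of_nonneg fun i _ => t1 i).1 z1 i (Finset.mem_univ i)
    have a2 : ∀ i j, pr i * P i j * (x i - x j) ^ 2 = 0 := fun i j =>
      (Finset.sum_eq_zero_iff_of_nonneg fun j _ => t2 i j).1
        ((Finset.sum_eq_zero_iff_of_nonneg
          fun i _ => Finset.sum_nonneg fun j _ => t2 i j).1 z2 i (Finset.mem_univ i))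
        j (Finset.mem_univ j)
    have step : ∀ i j, P i j ≠ 0 → x i = x j := by
      intro i j hij
      have h0 := a2 i j
      simp only [mul_eq_zero, (hprpos i).ne', hij, false_or] at h0
      exact sub_eq_zero.1 (pow_eq_zero_iff two_ne_zero |>.1 h0)
    have path : ∀ k : ℕ, ∀ i j, (P ^ k) i j ≠ 0 → x i = x j := by
      intro k
      induction k with
      | zero =>
        intro i j hij
        by_cases e : i = j
        · rw [e]
        · exact absurd (by simp [Matrix.one_apply_ne e]) hij
      | succ k ih =>
        intro i j hij
        rw [pow_succ, Matrix.mul_apply] at hij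
        obtain ⟨l, _, hl⟩ := Finset.exists_ne_zero_of_sum_ne_zero hij
        exact (ih i l (left_ne_zero_of_mul hl)).trans (step l j (right_ne_zero_of_mul hl))
    obtain ⟨i, _, hi⟩ := Finset.exists_ne_zero_of_sum_ne_zero hhsum.ne'
    have xi : x i = 0 := by
      have h0 := a1 i
      simpa [hi] using h0
    apply hx
    funext j
    obtain ⟨k, _, hk⟩ := hirr i j
    rw [← path k i j hk.ne', xi]
    rfl
  have hdet : IsUnit (Matrix.diagonal h - Matrix.diagonal pr * (P - 1)).det := by
    rw [isUnit_iff_ne_zero]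
    intro h0
    obtain ⟨v, hv, hv0⟩ := Matrix.exists_mulVec_eq_zero_iff.2 h0
    have := hpos v hv
    rw [hv0] at this
    simp at this
  refine ⟨hpos, hdet, ?_⟩
  intro x hx
  generalize Matrix.diagonal h - Matrix.diagonal pr * (P - 1) = M at hpos hdet
  have hxe : M *ᵥ (M⁻¹ *ᵥ x) = x := by
    rw [Matrix.mulVec_mulVec, Matrix.mul_nonsing_inv _ hdet, Matrix.one_mulVec]
  have hy : M⁻¹ *ᵥ x ≠ 0 := by
    intro h0
    rw [h0, Matrix.mulVec_zero] at hxe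
    exact hx hxe.symm
  have := hpos _ hy
  rwa [hxe, dotProduct_comm] at this
end

section
/- Let G be an n×n real symmetric positive definite matrix (n ≥ 2), Q := −G⁻¹, written in block form with scalar block Q₁₁, column Q_{*1} ∈ ℝⁿ⁻¹, row Q_{1*}, and block Q_{**} over indices 2,…,n; then −Q_{**} is symmetric positive definite. Let Ũ ∼ N(0,G) be a centered Gaussian vector in ℝⁿ. Then for Lebesgue-almost every r > 0, the conditional distribution of (Ũ₂², …, Ũₙ²) given Ũ₁² = r equals the law of (U₂², …, Uₙ²), where U ∼ N( −√r·Q_{**}^{−1}Q_{*1} , (−Q_{**})^{−1} ) is a Gaussian vector in ℝⁿ⁻¹ with mean −√r·Q_{**}^{−1}Q_{*1} and covariance (−Q_{**})^{−1}. -/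
open Matrix MeasureTheory ProbabilityTheory

/-- Probability measures on a Banach space are determined by a finite moment generating function. -/
lemma ext_of_exp_dual {E : Type*} [NormedAddCommGroup E] [NormedSpace ℝ E] [CompleteSpace E]
    [SecondCountableTopology E] [MeasurableSpace E] [BorelSpace E]
    (P P' : Measure E) [IsProbabilityMeasure P] [IsProbabilityMeasure P']
    (h : ∀ L : StrongDual ℝ E, ∫ x, Real.exp (L x) ∂P = ∫ x, Real.exp (L x) ∂P')
    (h0 : ∀ L : StrongDual ℝ E, ∫ x, Real.exp (L x) ∂P ≠ 0) : P = P' := by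
  apply Measure.ext_of_charFunDual
  ext L
  have hm : mgf L P = mgf L P' := by
    ext t
    simpa [mgf] using h (t • L)
  have hset : integrableExpSet L P = Set.univ := by
    ext t
    simp only [integrableExpSet, Set.mem_univ, iff_true]
    by_contra hc
    exact h0 (t • L) (by simpa using integral_undef hc)
  have := eqOn_complexMGF_of_mgf hm (show Complex.I ∈ _ by simp [hset])
  simp only [complexMGF] at this
  simp only [charFunDual_apply]
  simpa [mul_comm] using this

/-- Coordinate form of `ext_of_exp_dual`. -/
lemma ext_of_exp_pi {m : ℕ} (P P' : Measure (Fin m → ℝ)) [IsProbabilityMeasure P]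
    [IsProbabilityMeasure P'] (f : (Fin m → ℝ) → ℝ)
    (h : ∀ t : Fin m → ℝ, ∫ x, Real.exp (∑ i, t i * x i) ∂P = Real.exp (f t))
    (h' : ∀ t : Fin m → ℝ, ∫ x, Real.exp (∑ i, t i * x i) ∂P' = Real.exp (f t)) : P = P' := by
  have key : ∀ L : StrongDual ℝ (Fin m → ℝ), ∃ t : Fin m → ℝ, ∀ x, L x = ∑ i, t i * x i := by
    intro L
    refine ⟨fun i => L (Pi.single i 1), fun x => ?_⟩
    conv_lhs => rw [pi_eq_sum_univ' x]
    simp [mul_comm]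
  apply ext_of_exp_dual
  · intro L
    obtain ⟨t, ht⟩ := key L
    simp only [ht, h, h']
  · intro L
    obtain ⟨t, ht⟩ := key L
    simp only [ht, h]
    exact ne_of_gt (Real.exp_pos _)

/-- The Gaussian quadratic form in decorrelated coordinates. -/
lemma quad_decomp {m : ℕ} (G : Matrix (Fin (m + 1)) (Fin (m + 1)) ℝ) (hG : G.PosDef)
    (R : Matrix (Fin m) (Fin m) ℝ) (q : Fin m → ℝ) (hR : R.PosDef)
    (hRe : ∀ i j, R i j = G⁻¹ i.succ j.succ) (hq : ∀ i, q i = G⁻¹ i.succ 0)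
    (s : ℝ) (t : Fin m → ℝ) :
    let τ : Fin (m + 1) → ℝ := Fin.cons (s - ∑ i, t i * (-(R⁻¹ *ᵥ q) i)) t
    τ ⬝ᵥ G.mulVec τ = s ^ 2 * G 0 0 + t ⬝ᵥ R⁻¹.mulVec t := by
  intro τ
  have hGs : Gᵀ = G := by simpa using hG.isHermitian.eq
  have hGi : (G⁻¹)ᵀ = G⁻¹ := by rw [transpose_nonsing_inv, hGs]
  have hRs : Rᵀ = R := by simpa using hR.isHermitian.eq
  have hRi : (R⁻¹)ᵀ = R⁻¹ := by rw [transpose_nonsing_inv, hRs]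
  have hGu : IsUnit G.det := hG.det_pos.ne'.isUnit
  have hRu : IsUnit R.det := hR.det_pos.ne'.isUnit
  set σ : Fin (m + 1) → ℝ := Fin.cons (q ⬝ᵥ R⁻¹ *ᵥ t) t with hσ
  set y : Fin (m + 1) → ℝ := Fin.cons 0 (R⁻¹ *ᵥ t) with hy
  have hPy : G⁻¹ *ᵥ y = σ := by
    ext i
    refine Fin.cases ?_ (fun i => ?_) i
    · simp only [mulVec, dotProduct, Fin.sum_univ_succ, hy, hσ, Fin.cons_zero, Fin.cons_succ]
      simp only [mul_zero, zero_add]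
      refine Finset.sum_congr rfl fun j _ => ?_
      rw [hq, ← hGi, transpose_apply, hGi]
    · have : R *ᵥ (R⁻¹ *ᵥ t) = t := by rw [mulVec_mulVec, mul_nonsing_inv _ hRu, one_mulVec]
      simp only [hσ, Fin.cons_succ]
      conv_rhs => rw [← this]
      simp [mulVec, dotProduct, Fin.sum_univ_succ, hy, hRe]
  have hGσ : G *ᵥ σ = y := by
    rw [← hPy, mulVec_mulVec, mul_nonsing_inv _ hGu, one_mulVec]
  have hτ : τ = s • Pi.single 0 1 + σ := by
    ext i
    refine Fin.cases ?_ (fun i => ?_) i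
    · have : q ⬝ᵥ R⁻¹ *ᵥ t = t ⬝ᵥ R⁻¹ *ᵥ q := by
        rw [dotProduct_mulVec, ← mulVec_transpose, hRi, dotProduct_comm]
      simp only [τ, hσ, this]
      simp [dotProduct]
    · simp [τ, hσ]
  have h1 : σ ⬝ᵥ G *ᵥ (Pi.single 0 1) = 0 := by
    rw [dotProduct_mulVec, ← mulVec_transpose, hGs, hGσ]
    simp [hy]
  have h2 : σ ⬝ᵥ y = t ⬝ᵥ R⁻¹ *ᵥ t := by
    simp [hσ, hy, dotProduct, Fin.sum_univ_succ]
  rw [hτ, mulVec_add, mulVec_smul, hGσ, add_dotProduct, dotProduct_add, dotProduct_add,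
    dotProduct_smul, dotProduct_smul, h1, h2]
  simp [hy]
  ring

lemma main_cond {m : ℕ} {Ω : Type} [MeasurableSpace Ω] (μ : Measure Ω) [IsProbabilityMeasure μ]
    (X : Ω → ℝ) (W : Ω → Fin m → ℝ) (hX : Measurable X) (hW : Measurable W) (b : Fin m → ℝ)
    (c : ℝ) (C : Matrix (Fin m) (Fin m) ℝ)
    (h : ∀ (s : ℝ) (t : Fin m → ℝ), ∫ ω, Real.exp (s * X ω + ∑ i, t i * W ω i) ∂μ =
      Real.exp (c * s ^ 2 + (1 / 2 : ℝ) * (t ⬝ᵥ C.mulVec t))) :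
    ∀ᵐ r ∂(μ.map (fun ω => X ω ^ 2)),
      condDistrib (fun ω => fun i : Fin m => (b i * X ω + W ω i) ^ 2) (fun ω => X ω ^ 2) μ r
        = (μ.map W).map (fun w i => (b i * √r + w i) ^ 2) := by
  have : IsProbabilityMeasure (μ.map X) := Measure.isProbabilityMeasure_map hX.aemeasurable
  have : IsProbabilityMeasure (μ.map W) := Measure.isProbabilityMeasure_map hW.aemeasurable
  have hWt : ∀ t : Fin m → ℝ, ∫ x, Real.exp (∑ i, t i * x i) ∂(μ.map W)
      = Real.exp ((1 / 2 : ℝ) * (t ⬝ᵥ C.mulVec t)) := by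
    intro t
    rw [integral_map hW.aemeasurable (Measurable.aestronglyMeasurable (by fun_prop))]
    simpa using h 0 t
  have hXs : ∀ s : ℝ, ∫ x, Real.exp (s * x) ∂(μ.map X) = Real.exp (c * s ^ 2) := by
    intro s
    rw [integral_map hX.aemeasurable (by fun_prop)]
    simpa using h s 0
  have hind : μ.map (fun ω => (X ω, W ω)) = (μ.map X).prod (μ.map W) := by
    have : IsProbabilityMeasure (μ.map (fun ω => (X ω, W ω))) :=
      Measure.isProbabilityMeasure_map (by fun_prop)
    have key : ∀ L : StrongDual ℝ (ℝ × (Fin m → ℝ)), ∃ (s : ℝ) (t : Fin m → ℝ),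
        ∀ x, L x = s * x.1 + ∑ i, t i * x.2 i := by
      intro L
      refine ⟨L (1, 0), fun i => L (0, Pi.single i 1), fun x => ?_⟩
      have e1 : L x = L (x.1, 0) + L (0, x.2) := by rw [← map_add]; simp
      have e2 : L (x.1, 0) = L (1, 0) * x.1 := by
        have : ((x.1, 0) : ℝ × (Fin m → ℝ)) = x.1 • (1, 0) := by simp
        rw [this, map_smul, smul_eq_mul, mul_comm]
      have e3 : L (0, x.2) = (L.comp (ContinuousLinearMap.inr ℝ ℝ (Fin m → ℝ))) x.2 := by simp
      rw [e1, e2, e3]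
      conv_lhs => rw [pi_eq_sum_univ' x.2]
      simp [mul_comm]
    have hl : ∀ (s : ℝ) (t : Fin m → ℝ), ∫ x, Real.exp (s * x.1 + ∑ i, t i * x.2 i)
        ∂(μ.map (fun ω => (X ω, W ω))) =
        Real.exp (c * s ^ 2 + (1 / 2 : ℝ) * (t ⬝ᵥ C.mulVec t)) := by
      intro s t
      rw [integral_map (by fun_prop) (Measurable.aestronglyMeasurable (by fun_prop))]
      exact h s t
    apply ext_of_exp_dual
    · intro L
      obtain ⟨s, t, ht⟩ := key L
      simp only [ht]
      rw [hl]
      simp only [Real.exp_add]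
      rw [integral_prod_mul (fun x => Real.exp (s * x))
        (fun w : Fin m → ℝ => Real.exp (∑ i, t i * w i)), hXs, hWt]
    · intro L
      obtain ⟨s, t, ht⟩ := key L
      simp only [ht]
      rw [hl]
      exact ne_of_gt (Real.exp_pos _)
  have hsym : (μ.map W).map (fun w => -w) = μ.map W := by
    have : IsProbabilityMeasure ((μ.map W).map (fun w => -w)) :=
      Measure.isProbabilityMeasure_map (by fun_prop)
    refine ext_of_exp_pi _ _ (fun t => (1 / 2 : ℝ) * (t ⬝ᵥ C.mulVec t)) (fun t => ?_) hWt
    rw [integral_map (by fun_prop) (Measurable.aestronglyMeasurable (by fun_prop))]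
    have := hWt (-t)
    simpa [mulVec_neg] using this
  set ν := μ.map W with hν
  clear_value ν
  let F : ℝ × (Fin m → ℝ) → (Fin m → ℝ) := fun p i => (b i * √p.1 + p.2 i) ^ 2
  have hF : Measurable F := by fun_prop
  let κ : Kernel ℝ (Fin m → ℝ) := (Kernel.id ×ₖ Kernel.const ℝ ν).map F
  have hκm : IsMarkovKernel κ := Kernel.IsMarkovKernel.map _ hF
  have hκ : ∀ r, κ r = ν.map (fun w i => (b i * √r + w i) ^ 2) := by
    intro r
    ext S hS
    rw [Kernel.map_apply' _ hF _ hS, Kernel.id_prod_apply' _ _ (hF hS),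
      Measure.map_apply (by fun_prop) hS]
    rfl
  have hmain := condDistrib_ae_eq_of_measure_eq_compProd (μ := μ) (fun ω => X ω ^ 2)
    (Y := fun ω => fun i : Fin m => (b i * X ω + W ω i) ^ 2) (κ := κ) (by fun_prop) ?_
  · filter_upwards [hmain] with r hr
    rw [hr, hκ]
  apply Measure.ext_of_lintegral
  intro f hf
  rw [Measure.lintegral_compProd hf, lintegral_map hf (by fun_prop),
    lintegral_map (hf.lintegral_kernel_prod_right') (by fun_prop)]
  have e1 : ∫⁻ ω, f (X ω ^ 2, fun i => (b i * X ω + W ω i) ^ 2) ∂μ =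
      ∫⁻ p, f (p.1 ^ 2, fun i => (b i * p.1 + p.2 i) ^ 2) ∂(μ.map (fun ω => (X ω, W ω))) := by
    rw [lintegral_map (by fun_prop) (by fun_prop)]
  rw [e1, hind, lintegral_prod _ (by fun_prop), lintegral_map (by fun_prop) hX]
  refine lintegral_congr fun ω => ?_
  rw [hκ, lintegral_map (by fun_prop) (by fun_prop), Real.sqrt_sq_eq_abs]
  rcases abs_choice (X ω) with hx | hx <;> rw [hx]
  conv_lhs => rw [← hsym]
  rw [lintegral_map (by fun_prop) (by fun_prop)]
  refine lintegral_congr fun w => ?_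
  congr 2
  ext i
  simp only [Pi.neg_apply]
  ring

/-- **Conditioned χ-squared process.** Let `G` be an `(m+1) × (m+1)` real
symmetric positive definite matrix, `Q := −G⁻¹`, with blocks `Q_{**} i j = Q i.succ j.succ` and
`Q_{*1} i = Q i.succ 0`; then `−Q_{**}` is symmetric positive definite. Let `Ũ ∼ N(0,G)`
(characterized by its moment generating function). Then for almost every `r` with respect to the
law of `Ũ₁²`, with `r > 0`, the regular conditional distribution of `(Ũ₂²,…,Ũₙ²)` given
`Ũ₁² = r` equals the law of `(U₂²,…,Uₙ²)` for any Gaussian vector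
`U ∼ N(−√r·Q_{**}^{−1}Q_{*1}, (−Q_{**})⁻¹)` (again characterized via its moment generating
function `E[exp⟨t,U⟩] = exp(⟨t,mean⟩ + tᵀ(−Q_{**})⁻¹t/2)`). -/
theorem conditioned_chiSquare {m : ℕ} (G : Matrix (Fin (m + 1)) (Fin (m + 1)) ℝ)
    (hG : G.PosDef)
    {Ω : Type} [MeasurableSpace Ω] (μ : Measure Ω) [IsProbabilityMeasure μ]
    (U : Ω → Fin (m + 1) → ℝ) (hU : Measurable U)
    (hUmgf : ∀ t : Fin (m + 1) → ℝ,
      ∫ ω, Real.exp (∑ i, t i * U ω i) ∂μ = Real.exp ((1 / 2 : ℝ) * (t ⬝ᵥ G.mulVec t))) :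
    let Q : Matrix (Fin (m + 1)) (Fin (m + 1)) ℝ := -G⁻¹
    let Qss : Matrix (Fin m) (Fin m) ℝ := fun i j => Q i.succ j.succ
    let Qs1 : Fin m → ℝ := fun i => Q i.succ 0
    (-Qss).PosDef ∧
    ∀ᵐ r ∂(Measure.map (fun ω => (U ω 0) ^ 2) μ), 0 < r →
      ∀ (Ω' : Type) (_ : MeasurableSpace Ω') (μ' : Measure Ω') (_ : IsProbabilityMeasure μ')
        (V : Ω' → Fin m → ℝ), Measurable V →
        (∀ t : Fin m → ℝ, ∫ ω, Real.exp (∑ i, t i * V ω i) ∂μ' =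
          Real.exp ((∑ i, t i * (-(Real.sqrt r) * Qss⁻¹.mulVec Qs1 i)) +
            (1 / 2 : ℝ) * (t ⬝ᵥ ((-Qss)⁻¹).mulVec t))) →
        condDistrib (fun ω => fun i : Fin m => (U ω i.succ) ^ 2)
            (fun ω => (U ω 0) ^ 2) μ r =
          Measure.map (fun ω => fun i : Fin m => (V ω i) ^ 2) μ' := by
  intro Q Qss Qs1
  have hR : (-Qss).PosDef := by
    have : (-Qss) = (G⁻¹).submatrix Fin.succ Fin.succ := by
      ext i j
      rw [neg_apply]
      simp [Qss, Q]
    rw [this]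
    exact hG.inv.submatrix (Fin.succ_injective _)
  refine ⟨hR, ?_⟩
  have hRu : IsUnit (-Qss).det := hR.det_pos.ne'.isUnit
  have hQinv : Qss⁻¹ = -(-Qss)⁻¹ := by
    apply inv_eq_right_inv
    rw [mul_neg, ← neg_mul, mul_nonsing_inv _ hRu]
  set R := -Qss with hRdef
  have hb : ∀ i, (Qss⁻¹ *ᵥ Qs1) i = (R⁻¹ *ᵥ (-Qs1)) i := by
    intro i
    rw [hQinv, neg_mulVec, mulVec_neg]
  let b : Fin m → ℝ := fun i => -(R⁻¹ *ᵥ (-Qs1)) i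
  let W : Ω → Fin m → ℝ := fun ω i => U ω i.succ - b i * U ω 0
  have hW : Measurable W := by fun_prop
  have hjoint : ∀ (s : ℝ) (t : Fin m → ℝ), ∫ ω, Real.exp (s * U ω 0 + ∑ i, t i * W ω i) ∂μ =
      Real.exp ((G 0 0 / 2) * s ^ 2 + (1 / 2 : ℝ) * (t ⬝ᵥ R⁻¹.mulVec t)) := by
    intro s t
    have hd := quad_decomp G hG R (-Qs1) hR (fun i j => by
      rw [hRdef, neg_apply]
      simp [Qss, Q])
      (fun i => by simp [Qs1, Q]) s t
    have hu := hUmgf (Fin.cons (s - ∑ i, t i * b i) t)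
    simp only at hd
    rw [hd] at hu
    convert hu using 3
    · rename_i ω
      simp only [Fin.sum_univ_succ, Fin.cons_zero, Fin.cons_succ, W, mul_sub,
        Finset.sum_sub_distrib, sub_mul, Finset.sum_mul]
      simp only [mul_assoc]
      ring
    · ring
  have hmain := main_cond μ (fun ω => U ω 0) W (by fun_prop) hW b (G 0 0 / 2) R⁻¹ hjoint
  have hY : (fun ω => fun i : Fin m => (b i * U ω 0 + W ω i) ^ 2) =
      (fun ω => fun i : Fin m => (U ω i.succ) ^ 2) := by
    ext ω i
    simp only [W]
    ring
  rw [hY] at hmain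
  filter_upwards [hmain] with r hr _ Ω' _ μ' _ V hV hVmgf
  rw [hr]
  have hPW : IsProbabilityMeasure (μ.map W) := Measure.isProbabilityMeasure_map hW.aemeasurable
  have hs : Measurable (fun (w : Fin m → ℝ) i => b i * √r + w i) := by
    clear_value b
    fun_prop
  have hP1 : IsProbabilityMeasure ((μ.map W).map (fun w i => b i * √r + w i)) :=
    Measure.isProbabilityMeasure_map hs.aemeasurable
  have hP2 : IsProbabilityMeasure (μ'.map V) := Measure.isProbabilityMeasure_map hV.aemeasurable
  have hlaw : (μ.map W).map (fun w i => b i * √r + w i) = μ'.map V := by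
    refine ext_of_exp_pi _ _ (fun t => (∑ i, t i * (-(Real.sqrt r) * Qss⁻¹.mulVec Qs1 i)) +
            (1 / 2 : ℝ) * (t ⬝ᵥ R⁻¹.mulVec t)) (fun t => ?_) (fun t => ?_)
    · rw [integral_map hs.aemeasurable (Measurable.aestronglyMeasurable (by fun_prop)),
        integral_map hW.aemeasurable (Measurable.aestronglyMeasurable (by fun_prop))]
      have h0 := hjoint 0 t
      simp only [zero_mul, zero_add, ne_eq, OfNat.ofNat_ne_zero, not_false_eq_true, zero_pow,
        mul_zero] at h0
      simp only [mul_add, Finset.sum_add_distrib, Real.exp_add]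
      rw [integral_const_mul, h0]
      congr 2
      refine Finset.sum_congr rfl fun i _ => ?_
      rw [hb]
      simp only [b]
      ring
    · rw [integral_map (by fun_prop) (Measurable.aestronglyMeasurable (by fun_prop))]
      exact hVmgf t
  have e1 : (fun (w : Fin m → ℝ) i => (b i * √r + w i) ^ 2) =
      (fun (v : Fin m → ℝ) i => v i ^ 2) ∘ (fun w i => b i * √r + w i) := rfl
  have e2 : (fun ω => fun i : Fin m => (V ω i) ^ 2) =
      (fun (v : Fin m → ℝ) i => v i ^ 2) ∘ V := rfl
  rw [e1, e2, ← Measure.map_map (by fun_prop) hs, hlaw,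
    Measure.map_map (by fun_prop) hV]
end
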